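/- Suppose (Ω,F,P) is an atomless probability space and Φ is a Young function (not a priori assumed Δ2). Then the following are equivalent: (1) Φ satisfies the Δ2-condition; (2) every norm bounded sequence in L_{Φ*} has a subsequence whose Cesàro means converge in the Mackey topology τ(L_{Φ*},L_Φ); (3) every norm bounded sequence in L_{Φ*} has a sequence of forward convex combinations converging in the weak topology σ(L_{Φ*},L_Φ); (4) every norm bounded sequence (ξ_n) in L_{Φ*} has a sequence of forward convex combinations ξ̄_n ∈ conv(ξ_k : k ≥ n) that is order bounded, i.e. sup_n |ξ̄_n| ∈ L_{Φ*}. -/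

import Mathlib

open MeasureTheory Filter Topology Set
open scoped ENNReal

noncomputable section

namespace OrliczPaper

variable {Ω : Type*} [MeasurableSpace Ω]

/-- A (finite, coercive) Young function: an even convex function with `Φ 0 = 0`
and `Φ x / x → ∞` as `x → ∞`. -/
structure IsYoung (Φ : ℝ → ℝ) : Prop where
  even : ∀ x, Φ (-x) = Φ x
  convexOn : ConvexOn ℝ Set.univ Φ
  map_zero : Φ 0 = 0
  coercive : Tendsto (fun x => Φ x / x) atTop atTop

/-- The Δ₂-condition: `limsup_{x→∞} Φ(2x)/Φ(x) < ∞`, i.e. `Φ(2x) ≤ C Φ(x)`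
for all large `x`. -/
def Delta2 (Φ : ℝ → ℝ) : Prop :=
  ∃ C x₀ : ℝ, ∀ x ≥ x₀, Φ (2 * x) ≤ C * Φ x

/-- The conjugate Young function `Φ*(y) = sup_x (x y − Φ x)`. -/
def conj (Φ : ℝ → ℝ) (y : ℝ) : ℝ := ⨆ x : ℝ, x * y - Φ x

variable (P : Measure Ω)

/-- Membership in the Orlicz space `L_Φ`: a measurable function with
`E[Φ(l ξ)] < ∞` for some `l > 0`. -/
def MemOrlicz (Φ : ℝ → ℝ) (f : Ω → ℝ) : Prop :=
  Measurable f ∧ ∃ l : ℝ, 0 < l ∧ ∫⁻ ω, ENNReal.ofReal (Φ (l * f ω)) ∂P < ⊤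

/-- The Orlicz space `L_Φ`, as a set of (everywhere defined) measurable functions. -/
def Orlicz (Φ : ℝ → ℝ) : Set (Ω → ℝ) := {f | MemOrlicz P Φ f}

/-- The Luxemburg norm `‖f‖_Φ = inf {l > 0 : E[Φ(f/l)] ≤ 1}`. -/
def luxNorm (Φ : ℝ → ℝ) (f : Ω → ℝ) : ℝ :=
  sInf {l : ℝ | 0 < l ∧ ∫⁻ ω, ENNReal.ofReal (Φ (f ω / l)) ∂P ≤ 1}

/-- The Orlicz (dual) norm `‖f‖_{(Φ*)} = sup {E[g f] : E[Φ(g)] ≤ 1}`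
(the Young function `Φ` here is the one of the *predual*). -/
def orliczNorm (Φ : ℝ → ℝ) (f : Ω → ℝ) : ℝ :=
  sSup {r : ℝ | ∃ g : Ω → ℝ, Measurable g ∧
    (∫⁻ ω, ENNReal.ofReal (Φ (g ω)) ∂P) ≤ 1 ∧ r = ∫ ω, g ω * f ω ∂P}

/-- The bilinear pairing `⟨f, g⟩ = E[f g]`. -/
def pairing (f g : Ω → ℝ) : ℝ := ∫ ω, f ω * g ω ∂P

/-- The weak topology `σ(E, F)` on `E` induced by the pairing with `F`. -/
def weakT (E F : Set (Ω → ℝ)) : TopologicalSpace E :=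
  TopologicalSpace.induced
    (fun ξ : E => fun η : F => pairing P (ξ : Ω → ℝ) (η : Ω → ℝ)) inferInstance

/-- The absolutely convex (convex and balanced) `σ(F,E)`-compact subsets of `F`. -/
def dualSets (E F : Set (Ω → ℝ)) : Set (Set F) :=
  {A | Convex ℝ (Subtype.val '' A) ∧ Balanced ℝ (Subtype.val '' A) ∧
    @IsCompact _ (weakT P F E) A}

/-- The Mackey topology `τ(E, F)`: the topology on `E` of uniform convergence on
absolutely convex `σ(F,E)`-compact subsets of `F`. -/
def mackeyT (E F : Set (Ω → ℝ)) : TopologicalSpace E :=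
  TopologicalSpace.induced
    (fun ξ : E => UniformOnFun.ofFun (dualSets P E F)
      (fun η : F => pairing P (ξ : Ω → ℝ) (η : Ω → ℝ)))
    inferInstance

/-- A distance generating the topology of convergence in `P`-probability. -/
def probDist (f g : Ω → ℝ) : ℝ := ∫ ω, min |f ω - g ω| 1 ∂P

/-- The topology of convergence in probability, restricted to `E ⊆ L₀`. -/
def probT (E : Set (Ω → ℝ)) : TopologicalSpace E :=
  TopologicalSpace.generateFrom
    {U | ∃ f : E, ∃ ε : ℝ, 0 < ε ∧ U = {g : E | probDist P (f : Ω → ℝ) (g : Ω → ℝ) < ε}}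

/-- `L_∞`: essentially bounded measurable functions. -/
def Linf : Set (Ω → ℝ) := {f | Measurable f ∧ ∃ C : ℝ, ∀ᵐ ω ∂P, |f ω| ≤ C}

/-- `L_1`: integrable measurable functions. -/
def L1 : Set (Ω → ℝ) := {f | Measurable f ∧ Integrable f P}

/-- The essential supremum norm. -/
def linfNorm (f : Ω → ℝ) : ℝ := sInf {C : ℝ | 0 ≤ C ∧ ∀ᵐ ω ∂P, |f ω| ≤ C}

/-- Uniform integrability of a set of functions:
`sup_{f ∈ A} E[|f| 1_{|f| > N}] → 0`. -/
def UnifInt (A : Set (Ω → ℝ)) : Prop :=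
  Tendsto (fun N : ℕ => ⨆ f ∈ A, ∫⁻ ω in {ω | (N : ℝ) < |f ω|}, ENNReal.ofReal |f ω| ∂P)
    atTop (𝓝 0)

/-- Uniform integrability of a sequence of functions. -/
def UnifIntSeq (g : ℕ → Ω → ℝ) : Prop :=
  Tendsto (fun N : ℕ => ⨆ n, ∫⁻ ω in {ω | (N : ℝ) < |g n ω|}, ENNReal.ofReal |g n ω| ∂P)
    atTop (𝓝 0)

/-- The Cesàro means of a sequence of functions: `cesaro ξ N` is the average of
`ξ 0, …, ξ N`. -/
def cesaro (ξ : ℕ → Ω → ℝ) (N : ℕ) : Ω → ℝ :=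
  fun ω => (∑ i ∈ Finset.range (N + 1), ξ i ω) / (N + 1)

/-- `sup_n |ξ n| ∈ L_Φ` (order boundedness of the sequence `ξ` in `L_Φ`). -/
def supMem (Φ : ℝ → ℝ) (ξ : ℕ → Ω → ℝ) : Prop :=
  (∀ᵐ ω ∂P, BddAbove (Set.range fun n => |ξ n ω|)) ∧
    MemOrlicz P Φ (fun ω => ⨆ n, |ξ n ω|)

/-- `ξb` is a sequence of forward convex combinations of `ξ`:
`ξb n ∈ conv (ξ k ; k ≥ n)`. -/
def FwdConvComb (ξ ξb : ℕ → Ω → ℝ) : Prop :=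
  ∀ n, ξb n ∈ convexHull ℝ {g : Ω → ℝ | ∃ k ≥ n, g = ξ k}

/-- The left derivative of a convex function. -/
def leftDeriv (Φ : ℝ → ℝ) (y : ℝ) : ℝ :=
  ⨆ h : {h : ℝ // 0 < h}, (Φ y - Φ (y - (h : ℝ))) / (h : ℝ)

/-- `p_Φ(x) = sup_{y > x} y Φ'(y) / Φ(y)`. -/
def pPhiAt (Φ : ℝ → ℝ) (x : ℝ) : ℝ≥0∞ :=
  ⨆ y : {y : ℝ // x < y}, ENNReal.ofReal ((y : ℝ) * leftDeriv Φ (y : ℝ) / Φ (y : ℝ))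

/-- `p_Φ = inf_{x ≥ 0} p_Φ(x)`. -/
def pPhi (Φ : ℝ → ℝ) : ℝ≥0∞ := ⨅ x : {x : ℝ // 0 ≤ x}, pPhiAt Φ x

/-- `q_Φ = p_Φ / (p_Φ − 1)` (with `1/0 = ∞`). -/
def qPhi (Φ : ℝ → ℝ) : ℝ≥0∞ := pPhi Φ / (pPhi Φ - 1)

end OrliczPaper

namespace OrliczPaper

section Young

variable {Φ : ℝ → ℝ}

lemma IsYoung.nonneg (hΦ : IsYoung Φ) (x : ℝ) : 0 ≤ Φ x := by
  have h := hΦ.convexOn.2 (mem_univ x) (mem_univ (-x))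
    (by norm_num : (0 : ℝ) ≤ 1 / 2) (by norm_num : (0 : ℝ) ≤ 1 / 2) (by norm_num)
  simp only [smul_eq_mul, hΦ.even] at h
  rw [show (1 / 2 : ℝ) * x + 1 / 2 * -x = 0 by ring, hΦ.map_zero] at h
  linarith

lemma IsYoung.continuous (hΦ : IsYoung Φ) : Continuous Φ :=
  continuousOn_univ.1 (hΦ.convexOn.continuousOn isOpen_univ)

lemma IsYoung.map_mul_le (hΦ : IsYoung Φ) {t : ℝ} (h0 : 0 ≤ t) (h1 : t ≤ 1) (x : ℝ) :
    Φ (t * x) ≤ t * Φ x := by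
  have h := hΦ.convexOn.2 (mem_univ x) (mem_univ 0) h0 (sub_nonneg.2 h1) (by ring)
  simpa [hΦ.map_zero] using h

lemma IsYoung.map_abs (hΦ : IsYoung Φ) (x : ℝ) : Φ |x| = Φ x := by
  rcases abs_choice x with h | h <;> rw [h]
  exact hΦ.even x

lemma IsYoung.mono (hΦ : IsYoung Φ) {x y : ℝ} (h : |x| ≤ |y|) : Φ x ≤ Φ y := by
  rw [← hΦ.map_abs x, ← hΦ.map_abs y]
  rcases eq_or_lt_of_le (abs_nonneg y) with h0 | h0
  · rw [← h0] at h ⊢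
    rw [le_antisymm h (abs_nonneg x)]
  · have h1 : |x| / |y| ≤ 1 := (div_le_one h0).2 h
    have := hΦ.map_mul_le (div_nonneg (abs_nonneg x) h0.le) h1 |y|
    rw [div_mul_cancel₀ _ h0.ne'] at this
    exact this.trans (mul_le_of_le_one_left (hΦ.nonneg _) h1)

lemma IsYoung.add_le (hΦ : IsYoung Φ) {a b : ℝ} (x y : ℝ) (ha : 0 ≤ a) (hb : 0 ≤ b)
    (hab : a + b = 1) : Φ (a * x + b * y) ≤ a * Φ x + b * Φ y := by
  simpa using hΦ.convexOn.2 (mem_univ x) (mem_univ y) ha hb hab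

/-- A Young function eventually dominates every linear function. -/
lemma IsYoung.exists_linear_le (hΦ : IsYoung Φ) (K : ℝ) :
    ∃ R : ℝ, 0 < R ∧ ∀ x, R ≤ |x| → K * |x| ≤ Φ x := by
  obtain ⟨R, hR⟩ := eventually_atTop.1 (hΦ.coercive.eventually_ge_atTop K)
  refine ⟨max R 1, by positivity, fun x hx => ?_⟩
  have h1 := hR |x| ((le_max_left _ _).trans hx)
  have h2 : 0 < |x| := lt_of_lt_of_le (by positivity) hx
  rw [le_div_iff₀ h2, hΦ.map_abs] at h1
  exact h1

lemma IsYoung.bddAbove_conj (hΦ : IsYoung Φ) (y : ℝ) :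
    BddAbove (range fun x : ℝ => x * y - Φ x) := by
  obtain ⟨R, hR, h⟩ := hΦ.exists_linear_le |y|
  refine ⟨R * |y|, ?_⟩
  rintro _ ⟨x, rfl⟩
  have h1 : x * y ≤ |x| * |y| := (le_abs_self _).trans (abs_mul x y).le
  have h2 := hΦ.nonneg x
  rcases le_total R |x| with hx | hx
  · have := h x hx
    have : 0 ≤ R * |y| := by positivity
    simp only
    linarith [mul_comm |x| |y|]
  · have : |x| * |y| ≤ R * |y| := by gcongr
    simp only
    linarith

/-- Young's inequality. -/
lemma IsYoung.mul_le (hΦ : IsYoung Φ) (x y : ℝ) : x * y ≤ Φ x + conj Φ y := by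
  have := le_ciSup (hΦ.bddAbove_conj y) x
  unfold conj
  linarith

lemma conj_le {y c : ℝ} (h : ∀ x, x * y - Φ x ≤ c) : conj Φ y ≤ c := ciSup_le h

/-- The conjugate of a Young function is a Young function. -/
lemma IsYoung.isYoung_conj (hΦ : IsYoung Φ) : IsYoung (conj Φ) where
  even y := by
    refine le_antisymm (conj_le fun x => ?_) (conj_le fun x => ?_)
    · have := hΦ.mul_le (-x) y
      rw [hΦ.even] at this
      linarith
    · have := hΦ.mul_le (-x) (-y)
      rw [hΦ.even] at this
      linarith
  convexOn := by
    refine ⟨convex_univ, fun y _ z _ a b ha hb hab => conj_le fun x => ?_⟩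
    have h1 := mul_le_mul_of_nonneg_left (hΦ.mul_le x y) ha
    have h2 := mul_le_mul_of_nonneg_left (hΦ.mul_le x z) hb
    have h3 : Φ x = a * Φ x + b * Φ x := by rw [← add_mul, hab, one_mul]
    simp only [smul_eq_mul]
    rw [h3]
    linarith
  map_zero := by
    refine le_antisymm (conj_le fun x => ?_) ?_
    · have := hΦ.nonneg x
      linarith
    · have := hΦ.mul_le 0 0
      rw [hΦ.map_zero] at this
      linarith
  coercive := by
    refine tendsto_atTop.2 fun K => ?_
    filter_upwards [eventually_ge_atTop (max 1 (Φ (K + 1)))] with y hy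
    have h1 : 0 < y := lt_of_lt_of_le one_pos ((le_max_left _ _).trans hy)
    have h2 : Φ (K + 1) ≤ y := (le_max_right _ _).trans hy
    rw [le_div_iff₀ h1]
    linarith [hΦ.mul_le (K + 1) y]

/-- The dual form of the `Δ₂`-condition. -/
lemma Delta2.conj_div_le (hΦ : IsYoung Φ) (h : Delta2 Φ) :
    ∃ D : ℝ, 0 ≤ D ∧ ∀ ε > 0, ∃ N₀ : ℕ, ∀ N : ℕ, N₀ ≤ N → 0 < N →
      ∀ y, conj Φ (y / N) ≤ ε / N * conj Φ y + D := by
  obtain ⟨C₀, x₀, h⟩ := h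
  set l : ℝ := max C₀ 4 / 2 with hl
  have hl2 : 2 ≤ l := by
    rw [hl]
    linarith [le_max_right C₀ 4]
  have hC : C₀ ≤ 2 * l := by
    rw [hl]
    linarith [le_max_left C₀ 4]
  set D : ℝ := Φ (2 * x₀) with hD
  have hD0 : 0 ≤ D := hΦ.nonneg _
  have hdouble : ∀ x, Φ (2 * x) ≤ 2 * l * Φ x + D := by
    intro x
    rw [← hΦ.map_abs, ← hΦ.map_abs x, abs_mul, abs_two]
    have h0 := hΦ.nonneg |x|
    rcases le_total x₀ |x| with hx | hx
    · have := h _ hx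
      nlinarith
    · have : Φ (2 * |x|) ≤ D := by
        refine hΦ.mono ?_
        have := abs_nonneg x
        rw [abs_of_nonneg (by positivity)]
        exact (by linarith : 2 * |x| ≤ 2 * x₀).trans (le_abs_self _)
      nlinarith
  have hstep : ∀ y, conj Φ (y / l) ≤ (conj Φ y + D) / (2 * l) := by
    intro y
    refine conj_le fun x => ?_
    rw [le_div_iff₀ (by linarith)]
    have h1 := hΦ.mul_le (2 * x) y
    have h2 := hdouble x
    have h3 : (x * (y / l) - Φ x) * (2 * l) = 2 * x * y - 2 * l * Φ x := by
      field_simp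
    linarith
  have hiter : ∀ (j : ℕ) y, conj Φ (y / l ^ j) ≤ conj Φ y / (2 * l) ^ j + D := by
    intro j
    induction j with
    | zero => intro y; simpa using hD0
    | succ j ih =>
      intro y
      have h1 := hstep (y / l ^ j)
      rw [div_div, ← pow_succ] at h1
      refine h1.trans ?_
      have h2 := ih y
      rw [div_le_iff₀ (by linarith)]
      have h3 : (conj Φ y / (2 * l) ^ (j + 1) + D) * (2 * l)
          = conj Φ y / (2 * l) ^ j + 2 * l * D := by
        have : l ≠ 0 := by linarith
        rw [pow_succ]
        field_simp
      rw [h3]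
      nlinarith
  refine ⟨D, hD0, fun ε hε => ?_⟩
  obtain ⟨J, hJ⟩ := exists_pow_lt_of_lt_one (show 0 < ε / l by positivity)
    (show (1 / 2 : ℝ) < 1 by norm_num)
  obtain ⟨N₀, hN₀⟩ := exists_nat_ge (l ^ (J + 1))
  refine ⟨N₀, fun N hN hN1 y => ?_⟩
  obtain ⟨j, hj1, hj2⟩ := exists_nat_pow_near (x := (N : ℝ)) (y := l)
    (by exact_mod_cast hN1) (by linarith)
  have hJj : J ≤ j := by
    have : l ^ (J + 1) < l ^ (j + 1) :=
      lt_of_le_of_lt (hN₀.trans (by exact_mod_cast hN)) hj2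
    have := (pow_lt_pow_iff_right₀ (by linarith : 1 < l)).1 this
    omega
  have hNpos : (0 : ℝ) < N := by exact_mod_cast hN1
  have h1 : conj Φ (y / N) ≤ conj Φ (y / l ^ j) := by
    refine hΦ.isYoung_conj.mono ?_
    rw [abs_div, abs_div, abs_of_pos hNpos, abs_of_pos (by positivity : 0 < l ^ j)]
    gcongr
  have h2 : 1 / (2 * l) ^ j ≤ ε / N := by
    rw [div_le_div_iff₀ (by positivity) hNpos, mul_pow]
    have h3 : (1 / 2 : ℝ) ^ j ≤ ε / l :=
      (pow_le_pow_of_le_one (by norm_num) (by norm_num) hJj).trans hJ.le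
    rw [one_div, inv_pow, inv_le_iff_one_le_mul₀ (by positivity), div_mul_eq_mul_div,
      le_div_iff₀ (by linarith)] at h3
    calc 1 * (N : ℝ) ≤ l ^ (j + 1) := by linarith
      _ = 1 * l * l ^ j := by ring
      _ ≤ ε * 2 ^ j * l ^ j := by gcongr
      _ = ε * (2 ^ j * l ^ j) := by ring
  calc conj Φ (y / N) ≤ _ := h1.trans (hiter j y)
    _ = 1 / (2 * l) ^ j * conj Φ y + D := by ring
    _ ≤ _ := by
      have := hΦ.isYoung_conj.nonneg y
      gcongr

end Young

section OrliczSpace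

variable {Ω : Type*} [MeasurableSpace Ω] {P : Measure Ω} {Φ : ℝ → ℝ} {f g : Ω → ℝ}

lemma MemOrlicz.mono (hΦ : IsYoung Φ) (hg : MemOrlicz P Φ g) (hf : Measurable f)
    (h : ∀ᵐ ω ∂P, |f ω| ≤ |g ω|) : MemOrlicz P Φ f := by
  obtain ⟨-, l, hl, hfinint⟩ := hg
  refine ⟨hf, l, hl, lt_of_le_of_lt (lintegral_mono_ae ?_) hfinint⟩
  filter_upwards [h] with ω hω
  refine ENNReal.ofReal_le_ofReal (hΦ.mono ?_)
  rw [abs_mul, abs_mul]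
  gcongr

lemma MemOrlicz.const_mul (hf : MemOrlicz P Φ f) (hΦ : IsYoung Φ) (c : ℝ) :
    MemOrlicz P Φ (fun ω => c * f ω) := by
  obtain ⟨hm, l, hl, hfinint⟩ := hf
  refine ⟨hm.const_mul c, l / (|c| + 1), by positivity,
    lt_of_le_of_lt (lintegral_mono fun ω => ?_) hfinint⟩
  refine ENNReal.ofReal_le_ofReal (hΦ.mono ?_)
  rw [abs_mul, abs_mul, abs_mul, abs_div, abs_of_pos (by positivity : 0 < |c| + 1),
    div_mul_eq_mul_div,
    div_le_iff₀ (by positivity)]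
  have : 0 ≤ |l| * |f ω| := by positivity
  nlinarith

lemma MemOrlicz.add (hf : MemOrlicz P Φ f) (hg : MemOrlicz P Φ g) (hΦ : IsYoung Φ) :
    MemOrlicz P Φ (fun ω => f ω + g ω) := by
  obtain ⟨hm, l, hl, hfinint⟩ := hf
  obtain ⟨hm', l', hl', hfinint'⟩ := hg
  refine ⟨hm.add hm', min l l' / 2, by positivity, ?_⟩
  have hmeas : Measurable fun ω => ENNReal.ofReal (Φ (l * f ω)) :=
    (hΦ.continuous.measurable.comp (hm.const_mul l)).ennreal_ofReal
  refine lt_of_le_of_lt (lintegral_mono (g := fun ω => ENNReal.ofReal (Φ (l * f ω))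
    + ENNReal.ofReal (Φ (l' * g ω))) fun ω => ?_)
    (by rw [lintegral_add_left hmeas]; exact ENNReal.add_lt_top.2 ⟨hfinint, hfinint'⟩)
  simp only
  rw [← ENNReal.ofReal_add (hΦ.nonneg _) (hΦ.nonneg _)]
  refine ENNReal.ofReal_le_ofReal ?_
  have h0 : 0 < min l l' := lt_min hl hl'
  have h1 := hΦ.add_le (min l l' * f ω) (min l l' * g ω) (by norm_num : (0 : ℝ) ≤ 1 / 2)
    (by norm_num : (0 : ℝ) ≤ 1 / 2) (by norm_num)
  have h2 : Φ (min l l' * f ω) ≤ Φ (l * f ω) := by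
    refine hΦ.mono ?_
    rw [abs_mul, abs_mul, abs_of_pos hl, abs_of_pos h0]
    exact mul_le_mul_of_nonneg_right (min_le_left _ _) (abs_nonneg _)
  have h3 : Φ (min l l' * g ω) ≤ Φ (l' * g ω) := by
    refine hΦ.mono ?_
    rw [abs_mul, abs_mul, abs_of_pos hl', abs_of_pos h0]
    exact mul_le_mul_of_nonneg_right (min_le_right _ _) (abs_nonneg _)
  rw [show min l l' / 2 * (f ω + g ω)
    = 1 / 2 * (min l l' * f ω) + 1 / 2 * (min l l' * g ω) by ring]
  linarith [hΦ.nonneg (l * f ω), hΦ.nonneg (l' * g ω)]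

lemma MemOrlicz.abs (hf : MemOrlicz P Φ f) (hΦ : IsYoung Φ) :
    MemOrlicz P Φ (fun ω => |f ω|) :=
  hf.mono hΦ (measurable_abs.comp hf.1) (by simp)

lemma memOrlicz_zero (hΦ : IsYoung Φ) : MemOrlicz P Φ (fun _ => 0) :=
  ⟨measurable_const, 1, one_pos, by simp [hΦ.map_zero]⟩

lemma memOrlicz_sum (hΦ : IsYoung Φ) {ι : Type*} (s : Finset ι) {f : ι → Ω → ℝ}
    (hf : ∀ i, MemOrlicz P Φ (f i)) : MemOrlicz P Φ (fun ω => ∑ i ∈ s, f i ω) := by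
  classical
  induction s using Finset.induction_on with
  | empty => simpa using memOrlicz_zero hΦ
  | insert a s ha ih =>
    simp only [Finset.sum_insert ha]
    exact (hf a).add ih hΦ

lemma memOrlicz_cesaro (hΦ : IsYoung Φ) {f : ℕ → Ω → ℝ} (hf : ∀ i, MemOrlicz P Φ (f i)) (N : ℕ) :
    MemOrlicz P Φ (cesaro f N) := by
  have := (memOrlicz_sum hΦ (Finset.range (N + 1)) hf).const_mul hΦ ((N + 1 : ℝ)⁻¹)
  convert this using 2
  rw [cesaro, div_eq_inv_mul]

lemma convex_orlicz (hΦ : IsYoung Φ) : Convex ℝ (Orlicz P Φ) :=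
  fun _ hf _ hg a b _ _ _ => (MemOrlicz.const_mul hf hΦ a).add (MemOrlicz.const_mul hg hΦ b) hΦ

lemma FwdConvComb.memOrlicz (hΦ : IsYoung Φ) {ξ ξb : ℕ → Ω → ℝ} (h : FwdConvComb ξ ξb)
    (hξ : ∀ n, MemOrlicz P Φ (ξ n)) (n : ℕ) : MemOrlicz P Φ (ξb n) :=
  convexHull_min (by rintro _ ⟨k, -, rfl⟩; exact hξ k) (convex_orlicz hΦ) (h n)

/-- Products of elements of dual Orlicz spaces are integrable. -/
lemma MemOrlicz.integrable_mul (hf : MemOrlicz P Φ f) (hg : MemOrlicz P (conj Φ) g)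
    (hΦ : IsYoung Φ) : Integrable (fun ω => f ω * g ω) P := by
  obtain ⟨hm, l, hl, hfinint⟩ := hf
  obtain ⟨hm', l', hl', hfinint'⟩ := hg
  have hi : Integrable (fun ω => Φ (l * f ω)) P :=
    ⟨(hΦ.continuous.measurable.comp (hm.const_mul l)).aestronglyMeasurable,
      (hasFiniteIntegral_iff_ofReal (ae_of_all _ fun _ => hΦ.nonneg _)).2 hfinint⟩
  have hi' : Integrable (fun ω => conj Φ (l' * g ω)) P :=
    ⟨(hΦ.isYoung_conj.continuous.measurable.comp (hm'.const_mul l')).aestronglyMeasurable,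
      (hasFiniteIntegral_iff_ofReal (ae_of_all _ fun _ => hΦ.isYoung_conj.nonneg _)).2 hfinint'⟩
  refine ((hi.add hi').const_mul (1 / (l * l'))).mono' (hm.mul hm').aestronglyMeasurable
    (ae_of_all _ fun ω => ?_)
  have h := hΦ.mul_le |l * f ω| |l' * g ω|
  rw [hΦ.map_abs, hΦ.isYoung_conj.map_abs, abs_mul, abs_mul, abs_of_pos hl, abs_of_pos hl'] at h
  rw [Real.norm_eq_abs, abs_mul, Pi.add_apply, one_div, ← div_eq_inv_mul,
    le_div_iff₀ (by positivity)]
  linarith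

lemma pairing_comm (f g : Ω → ℝ) : pairing P f g = pairing P g f := by
  simp only [pairing, mul_comm]

lemma lintegral_div_le_one (hΦ : IsYoung Φ) (hf : MemOrlicz P Φ f) {M M' : ℝ}
    (hM : luxNorm P Φ f ≤ M) (hM' : M < M') :
    ∫⁻ ω, ENNReal.ofReal (Φ (f ω / M')) ∂P ≤ 1 := by
  have hne : {l : ℝ | 0 < l ∧ ∫⁻ ω, ENNReal.ofReal (Φ (f ω / l)) ∂P ≤ 1}.Nonempty := by
    obtain ⟨hm, l, hl, hfinint⟩ := hf
    set I := ∫⁻ ω, ENNReal.ofReal (Φ (l * f ω)) ∂P with hI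
    set t : ℝ := (I.toReal + 1)⁻¹ with ht
    have hI0 : 0 ≤ I.toReal := ENNReal.toReal_nonneg
    have ht0 : 0 < t := by positivity
    have ht1 : t ≤ 1 := inv_le_one_of_one_le₀ (by linarith)
    refine ⟨(t * l)⁻¹, by positivity, ?_⟩
    calc ∫⁻ ω, ENNReal.ofReal (Φ (f ω / (t * l)⁻¹)) ∂P
        ≤ ∫⁻ ω, ENNReal.ofReal t * ENNReal.ofReal (Φ (l * f ω)) ∂P := by
          refine lintegral_mono fun ω => ?_
          rw [← ENNReal.ofReal_mul ht0.le]
          refine ENNReal.ofReal_le_ofReal ?_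
          have := hΦ.map_mul_le ht0.le ht1 (l * f ω)
          rwa [div_inv_eq_mul, mul_comm, mul_assoc]
      _ = ENNReal.ofReal t * I :=
          lintegral_const_mul _
            (hΦ.continuous.measurable.comp (hm.const_mul l)).ennreal_ofReal
      _ = ENNReal.ofReal (t * I.toReal) := by
          rw [ENNReal.ofReal_mul ht0.le, ENNReal.ofReal_toReal hfinint.ne]
      _ ≤ 1 := by
          rw [ENNReal.ofReal_le_one, ht, inv_mul_le_iff₀ (by positivity)]
          linarith
  obtain ⟨l, ⟨hl0, hl⟩, hlM⟩ := exists_lt_of_csInf_lt hne (lt_of_le_of_lt hM hM')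
  refine le_trans (lintegral_mono fun ω => ENNReal.ofReal_le_ofReal (hΦ.mono ?_)) hl
  rw [abs_div, abs_div, abs_of_pos hl0, abs_of_pos (hl0.trans hlM)]
  gcongr

lemma luxNorm_le_one (hf : ∫⁻ ω, ENNReal.ofReal (Φ (f ω)) ∂P ≤ 1) : luxNorm P Φ f ≤ 1 :=
  csInf_le ⟨0, fun _ h => h.1.le⟩ ⟨one_pos, by simpa using hf⟩

end OrliczSpace

section GlidingHump

variable {Ω : Type*}

/-- Successive absolutely convex combinations `± g n + (1 - |g n|) G` along a list of indices
and signs. -/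
def hump (g : ℕ → Ω → ℝ) : List (ℕ × Bool) → Ω → ℝ
  | [] => fun _ => 0
  | p :: L => fun ω => (if p.2 then 1 else -1) * g p.1 ω + (1 - |g p.1 ω|) * hump g L ω

lemma abs_hump_le {g : ℕ → Ω → ℝ} (hg : ∀ n ω, |g n ω| ≤ 1) (L : List (ℕ × Bool)) (ω : Ω) :
    |hump g L ω| ≤ 1 := by
  induction L with
  | nil => simp [hump]
  | cons p L ih =>
    have h1 := hg p.1 ω
    have h2 : |(if p.2 then (1 : ℝ) else -1) * g p.1 ω| = |g p.1 ω| := by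
      split_ifs <;> simp
    have h3 : |(1 - |g p.1 ω|) * hump g L ω| ≤ 1 - |g p.1 ω| := by
      rw [abs_mul, abs_of_nonneg (by linarith)]
      exact mul_le_of_le_one_right (by linarith) ih
    calc _ ≤ _ := abs_add_le _ _
      _ ≤ |g p.1 ω| + (1 - |g p.1 ω|) := by rw [h2]; gcongr
      _ = 1 := by ring

lemma abs_hump_cons_sub_le {g : ℕ → Ω → ℝ} (hg : ∀ n ω, |g n ω| ≤ 1) (p : ℕ × Bool)
    (L : List (ℕ × Bool)) (ω : Ω) : |hump g (p :: L) ω - hump g L ω| ≤ 2 * |g p.1 ω| := by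
  have h2 : |(if p.2 then (1 : ℝ) else -1) * g p.1 ω| = |g p.1 ω| := by
    split_ifs <;> simp
  have h3 : |(|g p.1 ω|) * hump g L ω| ≤ |g p.1 ω| := by
    rw [abs_mul, abs_abs]
    exact mul_le_of_le_one_right (abs_nonneg _) (abs_hump_le hg L ω)
  calc |hump g (p :: L) ω - hump g L ω|
      = |(if p.2 then (1 : ℝ) else -1) * g p.1 ω - |g p.1 ω| * hump g L ω| := by
        simp only [hump]; ring_nf
    _ ≤ _ := abs_sub _ _
    _ ≤ 2 * |g p.1 ω| := by rw [h2]; linarith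

variable [MeasurableSpace Ω] {P : Measure Ω}

lemma measurable_hump {g : ℕ → Ω → ℝ} (hg : ∀ n, Measurable (g n)) (L : List (ℕ × Bool)) :
    Measurable (hump g L) := by
  induction L with
  | nil => exact measurable_const
  | cons p L ih =>
    exact ((hg p.1).const_mul _).add ((measurable_const.sub (measurable_abs.comp (hg p.1))).mul ih)

lemma integrable_mul_of_abs_le_one {f G : Ω → ℝ} (hf : Integrable f P) (hG : Measurable G)
    (hG1 : ∀ᵐ ω ∂P, |G ω| ≤ 1) : Integrable (fun ω => G ω * f ω) P :=
  hf.bdd_mul hG.aestronglyMeasurable hG1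

lemma tendsto_integral_mul_of_abs_le_one {f G : Ω → ℝ} {g : ℕ → Ω → ℝ} (hf : Integrable f P)
    (hg : ∀ n, Measurable (g n)) (hg1 : ∀ n ω, |g n ω| ≤ 1)
    (h : ∀ᵐ ω ∂P, Tendsto (fun n => g n ω) atTop (𝓝 (G ω))) :
    Tendsto (fun n => ∫ ω, g n ω * f ω ∂P) atTop (𝓝 (∫ ω, G ω * f ω ∂P)) := by
  refine tendsto_integral_of_dominated_convergence (fun ω => |f ω|)
    (fun n => (hg n).aestronglyMeasurable.mul hf.1) hf.abs (fun n => ae_of_all _ fun ω => ?_) ?_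
  · rw [Real.norm_eq_abs, abs_mul]
    exact mul_le_of_le_one_left (abs_nonneg _) (hg1 n ω)
  · filter_upwards [h] with ω hω using hω.mul_const _

set_option maxHeartbeats 1000000 in
/-- Uniformity of dominated convergence over a compact family of integrable functions, where the
topology makes integration against bounded functions continuous. -/
theorem not_forall_le_abs_integral [IsFiniteMeasure P] {X : Type*} [TopologicalSpace X] {A : Set X}
    (hA : IsCompact A) {f : X → Ω → ℝ} (hf : ∀ a ∈ A, Integrable (f a) P)
    (hcont : ∀ G : Ω → ℝ, Measurable G → (∀ᵐ ω ∂P, |G ω| ≤ 1) →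
      Continuous fun a => ∫ ω, G ω * f a ω ∂P)
    {g : ℕ → Ω → ℝ} (hg : ∀ n, Measurable (g n)) (hg1 : ∀ n ω, |g n ω| ≤ 1)
    (hg0 : ∀ᵐ ω ∂P, Tendsto (fun n => g n ω) atTop (𝓝 0))
    {a : ℕ → X} (ha : ∀ n, a n ∈ A) {ε : ℝ} (hε : 0 < ε) :
    ¬ ∀ n, ε ≤ |∫ ω, g n ω * f (a n) ω ∂P| := by
  intro hlow
  set U : Ultrafilter ℕ := hyperfilter ℕ with hU
  have hUtop : (U : Filter ℕ) ≤ atTop := Nat.hyperfilter_le_atTop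
  have hlimit : ∀ b : ℕ → X, (∀ n, b n ∈ A) → ∃ c ∈ A, Tendsto b U (𝓝 c) := by
    intro b hb
    exact hA.ultrafilter_le_nhds (U.map b) (le_principal_iff.2 (Filter.mem_map.2
      (Filter.univ_mem' hb)))
  obtain ⟨c, hcA, hc⟩ := hlimit a ha
  set F : ℕ → Ω → ℝ := fun n ω => f (a n) ω - f c ω with hF
  have hFi : ∀ n, Integrable (F n) P := fun n => (hf _ (ha n)).sub (hf c hcA)
  have hsplit : ∀ G : Ω → ℝ, Measurable G → (∀ᵐ ω ∂P, |G ω| ≤ 1) → ∀ n,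
      ∫ ω, G ω * F n ω ∂P = ∫ ω, G ω * f (a n) ω ∂P - ∫ ω, G ω * f c ω ∂P := by
    intro G hG hG1 n
    rw [← integral_sub (integrable_mul_of_abs_le_one (hf _ (ha n)) hG hG1)
      (integrable_mul_of_abs_le_one (hf c hcA) hG hG1)]
    simp only [hF, mul_sub]
  have hgabs0 : ∀ᵐ ω ∂P, Tendsto (fun n => |g n ω|) atTop (𝓝 0) := by
    filter_upwards [hg0] with ω hω using by simpa using hω.abs
  have hgabs : ∀ h : Ω → ℝ, Integrable h P →
      Tendsto (fun n => ∫ ω, |g n ω| * h ω ∂P) atTop (𝓝 0) := by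
    intro h hh
    simpa using tendsto_integral_mul_of_abs_le_one (G := fun _ => 0) hh
      (fun n => measurable_abs.comp (hg n)) (fun n ω => by simpa using hg1 n ω) hgabs0
  have hhm := measurable_hump hg
  have hh1 := abs_hump_le hg1
  have hstep : ∀ L : List (ℕ × Bool), ∃ p : ℕ × Bool,
      (∫ ω, |g p.1 ω| ∂P ≤ (1 / 2) ^ L.length) ∧
      (∀ q ∈ L, ∫ ω, |g p.1 ω| * |F q.1 ω| ∂P ≤ ε / 16 * (1 / 2) ^ L.length) ∧
      (∀ L' ∈ L.tails, |∫ ω, hump g L' ω * F p.1 ω ∂P| ≤ (1 / 2) ^ L.length) ∧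
      ε / 2 ≤ |∫ ω, hump g (p :: L) ω * F p.1 ω ∂P| := by
    intro L
    have hpos : (0 : ℝ) < (1 / 2) ^ L.length := by positivity
    have e1 : ∀ᶠ n in (U : Filter ℕ), ∫ ω, |g n ω| ∂P ≤ (1 / 2) ^ L.length := by
      have := hgabs (fun _ => 1) (integrable_const _)
      simp only [mul_one] at this
      exact hUtop (this.eventually_le_const hpos)
    have e2 : ∀ᶠ n in (U : Filter ℕ), ∀ q ∈ L,
        ∫ ω, |g n ω| * |F q.1 ω| ∂P ≤ ε / 16 * (1 / 2) ^ L.length := by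
      have : ∀ᶠ n in (U : Filter ℕ), ∀ q ∈ L.toFinset,
          ∫ ω, |g n ω| * |F q.1 ω| ∂P ≤ ε / 16 * (1 / 2) ^ L.length :=
        (eventually_all_finset _).2 fun q _ =>
          hUtop ((hgabs _ (hFi q.1).abs).eventually_le_const (by positivity))
      simpa using this
    have e3 : ∀ᶠ n in (U : Filter ℕ), ∀ L' ∈ L.tails,
        |∫ ω, hump g L' ω * F n ω ∂P| ≤ (1 / 2) ^ L.length := by
      have : ∀ᶠ n in (U : Filter ℕ), ∀ L' ∈ L.tails.toFinset,
          |∫ ω, hump g L' ω * F n ω ∂P| ≤ (1 / 2) ^ L.length := by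
        refine (eventually_all_finset _).2 fun L' _ => ?_
        have h1 := ((hcont _ (hhm L') (ae_of_all _ (hh1 L'))).tendsto c).comp hc
        have h2 := (h1.sub_const (∫ ω, hump g L' ω * f c ω ∂P)).abs
        rw [sub_self, abs_zero] at h2
        filter_upwards [h2.eventually_le_const hpos] with n hn
        rw [hsplit _ (hhm L') (ae_of_all _ (hh1 L'))]
        exact hn
      simpa only [List.mem_toFinset] using this
    have e4 : ∀ᶠ n in (U : Filter ℕ), ε / 2 ≤ |∫ ω, g n ω * F n ω ∂P| := by
      have h0 := (tendsto_integral_mul_of_abs_le_one (G := fun _ => 0) (hf c hcA) hg hg1 hg0).abs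
      simp only [zero_mul, integral_zero, abs_zero] at h0
      filter_upwards [hUtop (h0.eventually_le_const (half_pos hε))] with n hn
      rw [hsplit _ (hg n) (ae_of_all _ (hg1 n))]
      have := abs_sub_abs_le_abs_sub (∫ ω, g n ω * f (a n) ω ∂P) (∫ ω, g n ω * f c ω ∂P)
      linarith [hlow n]
    obtain ⟨n, h1, h2, h3, h4⟩ := (e1.and (e2.and (e3.and e4))).exists
    set b := ∫ ω, g n ω * F n ω ∂P with hb
    set d := ∫ ω, (1 - |g n ω|) * hump g L ω * F n ω ∂P with hd
    have hval : ∀ s : Bool, ∫ ω, hump g ((n, s) :: L) ω * F n ω ∂P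
        = (if s then 1 else -1) * b + d := by
      intro s
      rw [hb, hd, ← integral_const_mul, ← integral_add]
      · simp only [hump]
        congr 1
        ext ω
        ring
      · exact (integrable_mul_of_abs_le_one (hFi n) (hg n) (ae_of_all _ (hg1 n))).const_mul _
      · refine integrable_mul_of_abs_le_one (hFi n)
          ((measurable_const.sub (measurable_abs.comp (hg n))).mul (hhm L))
          (ae_of_all _ fun ω => ?_)
        have := hg1 n ω
        have := abs_nonneg (g n ω)
        rw [abs_mul, abs_of_nonneg (by linarith : 0 ≤ 1 - |g n ω|)]
        exact mul_le_one₀ (by linarith) (abs_nonneg _) (hh1 L ω)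
    have hsign : ∃ s : Bool, |b| ≤ |(if s then 1 else -1) * b + d| := by
      by_contra! hcon
      have h5 := hcon true
      have h6 := hcon false
      simp only [if_true, one_mul, Bool.false_eq_true, if_false, neg_mul] at h5 h6
      have h7 : |2 * b| ≤ |b + d| + |-b + d| := by
        rw [show 2 * b = (b + d) - (-b + d) by ring]
        exact abs_sub _ _
      rw [abs_mul, abs_two] at h7
      linarith
    obtain ⟨s, hs⟩ := hsign
    exact ⟨(n, s), h1, h2, h3, by rw [hval]; exact h4.trans hs⟩
  choose step s1 s2 s3 s4 using hstep
  let Ls : ℕ → List (ℕ × Bool) := fun k => Nat.rec [] (fun _ L => step L :: L) k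
  have hLs : ∀ k, Ls (k + 1) = step (Ls k) :: Ls k := fun k => rfl
  have hlen : ∀ k, (Ls k).length = k := by
    intro k
    induction k with
    | zero => rfl
    | succ k ih => rw [hLs, List.length_cons, ih]
  have hsuf : ∀ j k, j ≤ k → Ls j <:+ Ls k := by
    intro j k hjk
    induction k, hjk using Nat.le_induction with
    | base => exact List.suffix_refl _
    | succ k _ ih => exact ih.trans (List.suffix_cons _ _)
  have hmem : ∀ j k, j < k → step (Ls j) ∈ Ls k := fun j k hjk =>
    (hsuf (j + 1) k hjk).subset (by rw [hLs]; exact List.mem_cons_self)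
  set n : ℕ → ℕ := fun k => (step (Ls k)).1 with hn
  set H : ℕ → Ω → ℝ := fun k => hump g (Ls k) with hH
  have hHstep : ∀ k ω, |H (k + 1) ω - H k ω| ≤ 2 * |g (n k) ω| := fun k ω =>
    abs_hump_cons_sub_le hg1 _ _ ω
  have hgm : ∀ k, AEMeasurable (fun ω => ENNReal.ofReal |g (n k) ω|) P := fun k =>
    (measurable_abs.comp (hg (n k))).ennreal_ofReal.aemeasurable
  have hsummable : ∀ᵐ ω ∂P, Summable fun k => |g (n k) ω| := by
    have hfin : ∫⁻ ω, ∑' k, ENNReal.ofReal |g (n k) ω| ∂P ≠ ⊤ := by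
      rw [lintegral_tsum hgm]
      refine ne_top_of_le_ne_top (b := ∑' k : ℕ, ENNReal.ofReal ((1 / 2 : ℝ) ^ k)) ?_
        (ENNReal.tsum_le_tsum fun k => ?_)
      · rw [← ENNReal.ofReal_tsum_of_nonneg (fun k => by positivity) summable_geometric_two]
        exact ENNReal.ofReal_ne_top
      · rw [← ofReal_integral_eq_lintegral_ofReal _ (ae_of_all _ fun _ => abs_nonneg _)]
        · refine ENNReal.ofReal_le_ofReal ?_
          have := s1 (Ls k)
          rwa [hlen] at this
        · exact (Integrable.of_bound (hg _).aestronglyMeasurable 1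
            (ae_of_all _ (hg1 _))).abs
    filter_upwards [ae_lt_top' (AEMeasurable.tsum hgm) hfin] with ω hω
    have := ENNReal.summable_toReal hω.ne
    simpa [ENNReal.toReal_ofReal (abs_nonneg _)] using this
  have hconv : ∀ᵐ ω ∂P, ∃ l : ℝ, Tendsto (fun k => H k ω) atTop (𝓝 l) := by
    filter_upwards [hsummable] with ω hω
    refine cauchySeq_tendsto_of_complete (cauchySeq_of_dist_le_of_summable
      (fun k => 2 * |g (n k) ω|) (fun k => ?_) (hω.mul_left 2))
    rw [dist_comm, Real.dist_eq]
    exact hHstep k ω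
  obtain ⟨G, hGm, hG⟩ := measurable_limit_of_tendsto_metrizable_ae
    (fun k => (hhm (Ls k)).aemeasurable) hconv
  have hG1 : ∀ᵐ ω ∂P, |G ω| ≤ 1 := by
    filter_upwards [hG] with ω hω
    exact le_of_tendsto hω.abs (Eventually.of_forall fun k => hh1 _ ω)
  have hbig : ∀ k m, k + 1 ≤ m →
      ε / 4 + ε / 4 * (1 / 2) ^ m ≤ |∫ ω, H m ω * F (n k) ω ∂P| := by
    intro k m hkm
    induction m, hkm using Nat.le_induction with
    | base =>
      have h1 : ((1 : ℝ) / 2) ^ (k + 1) ≤ 1 := pow_le_one₀ (by norm_num) (by norm_num)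
      have h2 := s4 (Ls k)
      rw [← hLs] at h2
      change ε / 2 ≤ |∫ ω, H (k + 1) ω * F (n k) ω ∂P| at h2
      nlinarith
    | succ m hm ih =>
      have hi : ∀ j, Integrable (fun ω => H j ω * F (n k) ω) P := fun j =>
        integrable_mul_of_abs_le_one (hFi _) (hhm _) (ae_of_all _ (hh1 _))
      have h1 : |∫ ω, H (m + 1) ω * F (n k) ω ∂P - ∫ ω, H m ω * F (n k) ω ∂P|
          ≤ 2 * (ε / 16 * (1 / 2) ^ m) := by
        rw [← integral_sub (hi (m + 1)) (hi m)]
        have h2 := s2 (Ls m) _ (hmem k m hm)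
        rw [hlen] at h2
        refine le_trans ?_ (mul_le_mul_of_nonneg_left h2 zero_le_two)
        rw [← integral_const_mul]
        have h4 : Integrable (fun ω => |g (n m) ω| * |F (n k) ω|) P :=
          integrable_mul_of_abs_le_one (hFi (n k)).abs (measurable_abs.comp (hg (n m)))
            (ae_of_all _ fun ω => (abs_abs (g (n m) ω)).trans_le (hg1 (n m) ω))
        refine abs_integral_le_integral_abs.trans
          (integral_mono ((hi (m + 1)).sub (hi m)).abs (h4.const_mul 2) fun ω => ?_)
        simp only [← sub_mul, abs_mul]
        rw [← mul_assoc]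
        exact mul_le_mul_of_nonneg_right (hHstep m ω) (abs_nonneg _)
      have h3 := abs_sub_abs_le_abs_sub (∫ ω, H m ω * F (n k) ω ∂P)
        (∫ ω, H (m + 1) ω * F (n k) ω ∂P)
      rw [abs_sub_comm] at h3
      rw [pow_succ]
      linarith
  have hGbig : ∀ k, ε / 4 ≤ |∫ ω, G ω * F (n k) ω ∂P| := by
    intro k
    refine ge_of_tendsto (tendsto_integral_mul_of_abs_le_one (hFi (n k)) (fun m => hhm (Ls m))
      (fun m => hh1 (Ls m)) hG).abs ?_
    filter_upwards [eventually_ge_atTop (k + 1)] with m hm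
    have := hbig k m hm
    have h2 : 0 ≤ ε / 4 * (1 / 2) ^ m := by positivity
    exact (by linarith : ε / 4 ≤ _).trans this
  obtain ⟨κ, hκA, hκ⟩ := hlimit (fun k => a (n k)) fun k => ha _
  have hlimF : ∀ G : Ω → ℝ, Measurable G → (∀ᵐ ω ∂P, |G ω| ≤ 1) →
      Tendsto (fun k => ∫ ω, G ω * F (n k) ω ∂P) U
        (𝓝 (∫ ω, G ω * f κ ω ∂P - ∫ ω, G ω * f c ω ∂P)) := by
    intro G hG hG1
    simp only [hsplit G hG hG1]
    exact (((hcont G hG hG1).tendsto κ).comp hκ).sub_const _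
  have hHκ : ∀ j, ∫ ω, H j ω * f κ ω ∂P = ∫ ω, H j ω * f c ω ∂P := by
    intro j
    refine sub_eq_zero.1 (tendsto_nhds_unique (hlimF _ (hhm _) (ae_of_all _ (hh1 _))) ?_)
    refine squeeze_zero_norm' ?_ ((tendsto_pow_atTop_nhds_zero_of_lt_one
      (by norm_num : (0 : ℝ) ≤ 1 / 2)
      (by norm_num)).mono_left hUtop)
    filter_upwards [hUtop (eventually_ge_atTop j)] with k hk
    have := s3 (Ls k) (Ls j) ((List.mem_tails _ _).2 (hsuf j k hk))
    rwa [hlen] at this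
  have hGκ : ∫ ω, G ω * f κ ω ∂P = ∫ ω, G ω * f c ω ∂P := by
    refine tendsto_nhds_unique (tendsto_integral_mul_of_abs_le_one (hf κ hκA)
      (fun m => hhm (Ls m)) (fun m => hh1 (Ls m)) hG) ?_
    have := tendsto_integral_mul_of_abs_le_one (hf c hcA) (fun m => hhm (Ls m))
      (fun m => hh1 (Ls m)) hG
    exact this.congr fun j => (hHκ j).symm
  have hfinal := (hlimF G hGm hG1).abs
  rw [hGκ, sub_self, abs_zero] at hfinal
  have := ge_of_tendsto hfinal (Eventually.of_forall hGbig)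
  linarith

end GlidingHump

section Hilbert

variable {H : Type*} [NormedAddCommGroup H] [InnerProductSpace ℝ H]

lemma exists_tendsto_inner_of_bounded [CompleteSpace H] (U : Ultrafilter ℕ) {x : ℕ → H} {C : ℝ}
    (hx : ∀ n, ‖x n‖ ≤ C) :
    ∃ y : H, ∀ z, Tendsto (fun n => inner ℝ (x n) z) U (𝓝 (inner ℝ y z)) := by
  have hcomp := WeakDual.isCompact_closedBall (𝕜 := ℝ) (0 : StrongDual ℝ H) C
  obtain ⟨ℓ, -, hℓ⟩ := hcomp.ultrafilter_le_nhds
    (U.map fun n => StrongDual.toWeakDual (InnerProductSpace.toDual ℝ H (x n)))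
    (le_principal_iff.2 (Filter.mem_map.2 (Filter.univ_mem' fun n => by
      simpa using hx n)))
  refine ⟨(InnerProductSpace.toDual ℝ H).symm (WeakDual.toStrongDual ℓ), fun z => ?_⟩
  have h := ((WeakDual.eval_continuous z).tendsto ℓ).comp (f := fun n =>
    StrongDual.toWeakDual (InnerProductSpace.toDual ℝ H (x n))) (x := (U : Filter ℕ)) hℓ
  rw [InnerProductSpace.toDual_symm_apply]
  exact h.congr fun n => InnerProductSpace.toDual_apply_apply

/-- Cesàro means of an almost orthogonal bounded sequence tend to zero. -/
lemma tendsto_cesaro_zero_of_inner {w : ℕ → H} {C : ℝ} (hw : ∀ n, ‖w n‖ ≤ C) {i : ℕ}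
    (h : ∀ j k, j < k → i ≤ k → |inner ℝ (w j) (w k)| ≤ (1 / 4) ^ k) :
    Tendsto (fun N : ℕ => ((N : ℝ) + 1)⁻¹ • ∑ j ∈ Finset.range (N + 1), w j) atTop (𝓝 0) := by
  set s : ℕ → H := fun N => ∑ j ∈ Finset.range N, w j with hs
  have hC : 0 ≤ C := (norm_nonneg _).trans (hw 0)
  have hbound : ∀ N, i ≤ N → ‖s N‖ ^ 2 ≤ ‖s i‖ ^ 2 + N * (C ^ 2 + 2) := by
    intro N hN
    induction N, hN using Nat.le_induction with
    | base =>
      have : 0 ≤ (i : ℝ) * (C ^ 2 + 2) := by positivity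
      linarith
    | succ N hN ih =>
      have h1 : |inner ℝ (s N) (w N)| ≤ 1 := by
        rw [hs, sum_inner]
        refine (Finset.abs_sum_le_sum_abs _ _).trans ?_
        refine (Finset.sum_le_sum fun j hj => h j N (Finset.mem_range.1 hj) hN).trans ?_
        rw [Finset.sum_const, Finset.card_range, nsmul_eq_mul, one_div, inv_pow]
        refine mul_inv_le_one_of_le₀ ?_ (by positivity)
        exact_mod_cast (Nat.lt_pow_self (by norm_num : 1 < 4)).le
      have h2 : s (N + 1) = s N + w N := Finset.sum_range_succ _ _
      rw [h2, norm_add_sq_real]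
      have h3 : ‖w N‖ ^ 2 ≤ C ^ 2 := pow_le_pow_left₀ (norm_nonneg _) (hw N) 2
      push_cast
      linarith [(abs_le.1 h1).2]
  have hsq : Tendsto (fun N : ℕ => ‖((N : ℝ) + 1)⁻¹ • s (N + 1)‖ ^ 2) atTop (𝓝 0) := by
    have hlim : Tendsto (fun N : ℕ => (‖s i‖ ^ 2 + (C ^ 2 + 2)) * (1 / ((N : ℝ) + 1)))
        atTop (𝓝 0) := by
      simpa using (tendsto_one_div_add_atTop_nhds_zero_nat (𝕜 := ℝ)).const_mul
        (‖s i‖ ^ 2 + (C ^ 2 + 2))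
    refine squeeze_zero' (Eventually.of_forall fun N => by positivity) ?_ hlim
    filter_upwards [eventually_ge_atTop i] with N hN
    have h1 := hbound (N + 1) (by omega)
    have hpos : (0 : ℝ) < (N : ℝ) + 1 := by positivity
    rw [norm_smul, mul_pow, norm_inv, Real.norm_eq_abs, abs_of_pos hpos]
    rw [inv_pow, ← div_eq_inv_mul, mul_one_div, div_le_div_iff₀ (by positivity) hpos]
    push_cast at h1
    have h2 : (1 : ℝ) ≤ (N : ℝ) + 1 := by linarith [(Nat.cast_nonneg N : (0 : ℝ) ≤ N)]
    have h3 : ‖s i‖ ^ 2 ≤ ‖s i‖ ^ 2 * ((N : ℝ) + 1) :=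
      le_mul_of_one_le_right (by positivity) h2
    nlinarith
  rw [tendsto_zero_iff_norm_tendsto_zero]
  have := hsq.sqrt
  simpa [Real.sqrt_sq] using this

end Hilbert

section Clamp

/-- Truncation of a real number to `[-c, c]`. -/
def clamp (c x : ℝ) : ℝ := max (-c) (min c x)

lemma measurable_clamp (c : ℝ) : Measurable (clamp c) :=
  measurable_const.max (measurable_const.min measurable_id)

lemma abs_clamp_le {c : ℝ} (hc : 0 ≤ c) (x : ℝ) : |clamp c x| ≤ c :=
  abs_le.2 ⟨le_max_left _ _, max_le (by linarith) (min_le_left _ _)⟩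

lemma clamp_of_abs_le {c x : ℝ} (h : |x| ≤ c) : clamp c x = x := by
  rw [clamp, min_eq_right (abs_le.1 h).2, max_eq_right (abs_le.1 h).1]

lemma abs_sub_clamp_le {c : ℝ} (hc : 0 ≤ c) (x : ℝ) : |x - clamp c x| ≤ |x| := by
  rcases le_total |x| c with h | h
  · rw [clamp_of_abs_le h, sub_self, abs_zero]; exact abs_nonneg x
  · rcases le_total 0 x with hx | hx
    · rw [abs_of_nonneg hx] at h ⊢
      rw [clamp, min_eq_left h, max_eq_right (by linarith), abs_of_nonneg] <;> linarith
    · rw [abs_of_nonpos hx] at h ⊢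
      rw [clamp, min_eq_right (by linarith), max_eq_left (by linarith), abs_of_nonpos] <;> linarith

end Clamp

section CesaroL1

variable {Ω : Type*}

lemma cesaro_eq_smul (f : ℕ → Ω → ℝ) (N : ℕ) :
    cesaro f N = ((N : ℝ) + 1)⁻¹ • ∑ j ∈ Finset.range (N + 1), f j := by
  ext ω
  simp [cesaro, div_eq_inv_mul]

lemma abs_cesaro_sub_cesaro_le (f g : ℕ → Ω → ℝ) (N : ℕ) (ω : Ω) :
    |cesaro f N ω - cesaro g N ω| ≤ cesaro (fun j ω => |f j ω - g j ω|) N ω := by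
  have hpos : (0 : ℝ) < (N : ℝ) + 1 := by positivity
  rw [cesaro, cesaro, cesaro, ← sub_div, ← Finset.sum_sub_distrib, abs_div, abs_of_pos hpos]
  gcongr
  exact Finset.abs_sum_le_sum_abs _ _

variable [MeasurableSpace Ω] {P : Measure Ω}

lemma measurable_cesaro {f : ℕ → Ω → ℝ} (hf : ∀ n, Measurable (f n)) (N : ℕ) :
    Measurable (cesaro f N) :=
  (Finset.measurable_fun_sum _ fun i _ => hf i).div_const _

lemma memLp_cesaro {p : ℝ≥0∞} {f : ℕ → Ω → ℝ} (hf : ∀ n, MemLp (f n) p P) (N : ℕ) :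
    MemLp (cesaro f N) p P := by
  rw [cesaro_eq_smul]
  exact (memLp_finsetSum' _ fun i _ => hf i).const_smul _

lemma smul_sum_toLp {p : ℝ≥0∞} {f : ℕ → Ω → ℝ} (hf : ∀ n, MemLp (f n) p P) (N : ℕ) :
    ((N : ℝ) + 1)⁻¹ • ∑ j ∈ Finset.range (N + 1), (hf j).toLp (f j)
      = (memLp_cesaro hf N).toLp (cesaro f N) := by
  have hsum : ∀ M : ℕ, ∑ j ∈ Finset.range M, (hf j).toLp (f j)
      = (memLp_finsetSum' (Finset.range M) fun i _ => hf i).toLp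
        (∑ j ∈ Finset.range M, f j) := by
    intro M
    induction M with
    | zero => simp
    | succ M ih =>
      rw [Finset.sum_range_succ, ih, ← MemLp.toLp_add]
      exact MemLp.toLp_congr _ _ (by rw [Finset.sum_range_succ])
  rw [hsum, ← MemLp.toLp_const_smul]
  exact MemLp.toLp_congr _ _ (by rw [cesaro_eq_smul])

lemma lintegral_cesaro {f : ℕ → Ω → ℝ} (hf : ∀ n, Measurable (f n)) (hf0 : ∀ n ω, 0 ≤ f n ω)
    (N : ℕ) : ∫⁻ ω, ENNReal.ofReal (cesaro f N ω) ∂P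
      = (∑ j ∈ Finset.range (N + 1), ∫⁻ ω, ENNReal.ofReal (f j ω) ∂P) / ENNReal.ofReal (N + 1) := by
  have hpos : (0 : ℝ) < (N : ℝ) + 1 := by positivity
  have h1 : ∀ ω, ENNReal.ofReal (cesaro f N ω)
      = (∑ j ∈ Finset.range (N + 1), ENNReal.ofReal (f j ω)) / ENNReal.ofReal (N + 1) := by
    intro ω
    rw [cesaro, ENNReal.ofReal_div_of_pos hpos, ENNReal.ofReal_sum_of_nonneg fun j _ => hf0 j ω]
  simp only [h1, div_eq_mul_inv]
  rw [lintegral_mul_const _ (Finset.measurable_fun_sum _ fun i _ => (hf i).ennreal_ofReal),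
    lintegral_finsetSum _ fun i _ => (hf i).ennreal_ofReal]

lemma lintegral_cesaro_le {f : ℕ → Ω → ℝ} (hf : ∀ n, Measurable (f n)) (hf0 : ∀ n ω, 0 ≤ f n ω)
    {c : ℝ≥0∞} (hc : ∀ n, ∫⁻ ω, ENNReal.ofReal (f n ω) ∂P ≤ c) (N : ℕ) :
    ∫⁻ ω, ENNReal.ofReal (cesaro f N ω) ∂P ≤ c := by
  rw [lintegral_cesaro hf hf0]
  refine ENNReal.div_le_of_le_mul ?_
  refine (Finset.sum_le_sum fun j _ => hc j).trans ?_
  rw [Finset.sum_const, Finset.card_range, nsmul_eq_mul, mul_comm,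
    ENNReal.ofReal_add (Nat.cast_nonneg _) zero_le_one]
  simp

/-- If the Cesàro means of all truncations converge in `L²` and the sequence is uniformly close to
its truncations in `L¹`, then the Cesàro means converge in `L¹`. -/
lemma exists_tendsto_cesaro [IsProbabilityMeasure P] {ξ : ℕ → Ω → ℝ} (hξ : ∀ n, Measurable (ξ n))
    (hξi : ∀ n, MemLp (ξ n) 1 P)
    (htail : ∀ ε : ℝ≥0∞, 0 < ε → ∃ i : ℕ, ∀ n,
      ∫⁻ ω, ENNReal.ofReal |ξ n ω - clamp i (ξ n ω)| ∂P ≤ ε)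
    (htrunc : ∀ i : ℕ, ∃ y : Ω → ℝ, MemLp y 2 P ∧
      Tendsto (fun N => eLpNorm (cesaro (fun j ω => clamp i (ξ j ω)) N - y) 2 P) atTop (𝓝 0)) :
    ∃ ξ₀ : Ω → ℝ, Measurable ξ₀ ∧
      Tendsto (fun N => eLpNorm (cesaro ξ N - ξ₀) 1 P) atTop (𝓝 0) := by
  set a : ℕ → Lp ℝ 1 P := fun N => (memLp_cesaro hξi N).toLp _ with ha
  have hcauchy : CauchySeq a := by
    rw [EMetric.cauchySeq_iff']
    intro ε hε
    have hε8 : 0 < ε / 8 := ENNReal.div_pos hε.ne' (by norm_num)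
    obtain ⟨i, hi⟩ := htail (ε / 8) hε8
    obtain ⟨y, hy, hlim⟩ := htrunc i
    have hclm : ∀ n, Measurable fun ω => clamp i (ξ n ω) := fun n =>
      (measurable_clamp i).comp (hξ n)
    have hy1 : MemLp y 1 P := hy.mono_exponent (by norm_num)
    have hev : ∀ᶠ N in atTop, edist (a N) (hy1.toLp y) ≤ ε / 4 := by
      filter_upwards [(ENNReal.tendsto_nhds_zero.1 hlim) (ε / 8) hε8] with N hN
      rw [ha, Lp.edist_toLp_toLp]
      have hsplit : cesaro ξ N - y = (cesaro ξ N - cesaro (fun j ω => clamp i (ξ j ω)) N)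
          + (cesaro (fun j ω => clamp i (ξ j ω)) N - y) := by abel
      rw [hsplit]
      refine (eLpNorm_add_le ((measurable_cesaro hξ N).sub
        (measurable_cesaro hclm N)).aestronglyMeasurable
        ((measurable_cesaro hclm N).aestronglyMeasurable.sub hy.1) le_rfl).trans ?_
      have h1 : eLpNorm (cesaro ξ N - cesaro (fun j ω => clamp i (ξ j ω)) N) 1 P ≤ ε / 8 := by
        rw [eLpNorm_one_eq_lintegral_enorm]
        refine le_trans (lintegral_mono fun ω => ?_) (lintegral_cesaro_le
          (f := fun j ω => |ξ j ω - clamp i (ξ j ω)|)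
          (fun n => measurable_abs.comp ((hξ n).sub (hclm n))) (fun n ω => abs_nonneg _) hi N)
        rw [Pi.sub_apply, Real.enorm_eq_ofReal_abs]
        exact ENNReal.ofReal_le_ofReal (abs_cesaro_sub_cesaro_le _ _ N ω)
      have h2 := (eLpNorm_le_eLpNorm_of_exponent_le (μ := P) (p := 1) (q := 2) (by norm_num)
        ((measurable_cesaro hclm N).aestronglyMeasurable.sub hy.1)).trans hN
      refine (add_le_add h1 h2).trans_eq ?_
      rw [ENNReal.div_add_div_same, ← two_mul, mul_comm, mul_div_assoc, div_eq_mul_inv ε]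
      congr 1
      rw [show (8 : ℝ≥0∞) = 2 * 4 by norm_num, ENNReal.div_eq_inv_mul,
        ENNReal.mul_inv (by norm_num) (by norm_num), mul_comm, ← mul_assoc,
        ENNReal.mul_inv_cancel (by norm_num) (by norm_num), one_mul]
    obtain ⟨N, hN⟩ := eventually_atTop.1 hev
    rcases eq_or_ne ε ⊤ with rfl | hεt
    · exact ⟨0, fun n _ => edist_lt_top _ _⟩
    refine ⟨N, fun n hn => (edist_triangle_right _ _ (hy1.toLp y)).trans_lt
      ((add_le_add (hN n hn) (hN N le_rfl)).trans_lt ?_)⟩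
    rw [ENNReal.div_add_div_same, ← two_mul]
    refine ENNReal.div_lt_of_lt_mul ?_
    rw [mul_comm]
    exact (ENNReal.mul_lt_mul_iff_right hε.ne' hεt).2 (by norm_num)
  obtain ⟨ℓ, hℓ⟩ := cauchySeq_tendsto_of_complete hcauchy
  refine ⟨ℓ, (Lp.stronglyMeasurable ℓ).measurable, ?_⟩
  refine (Lp.tendsto_Lp_iff_tendsto_eLpNorm' a ℓ).1 hℓ |>.congr fun N => ?_
  refine eLpNorm_congr_ae ?_
  filter_upwards [(memLp_cesaro hξi N).coeFn_toLp] with ω hω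
  simp only [Pi.sub_apply, ha, hω]

end CesaroL1

section Selection

variable {H : Type*} [NormedAddCommGroup H] [InnerProductSpace ℝ H]

/-- Selection of a subsequence that is almost orthogonal after recentring (for countably many
bounded sequences in a Hilbert space), along which bounded numerical data nearly stabilize on
longer and longer ranges, and which meets a tail condition. -/
lemma exists_selection [CompleteSpace H] {F : ℕ → ℕ → ℝ} (hF : ∀ n i, F n i ∈ Icc (0 : ℝ) 1)
    {x : ℕ → ℕ → H} {C : ℕ → ℝ} (hx : ∀ i n, ‖x i n‖ ≤ C i)
    {R : ℕ → ℕ → ℕ → ℕ → Prop} (hR : ∀ n k, ∃ m₀, ∀ m, m₀ ≤ m → ∀ n', R n k m n')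
    (hRmono : ∀ n k k' m n', k ≤ k' → R n k' m n' → R n k m n') :
    ∃ n m : ℕ → ℕ, ∃ Fl : ℕ → ℝ, StrictMono n ∧ (∀ j, 4 ^ j ≤ m j) ∧
      (∀ i, Tendsto (fun n => F n i) (hyperfilter ℕ) (𝓝 (Fl i))) ∧
      (∀ j i, i ≤ m j → |F (n j) i - Fl i| ≤ (1 / 4) ^ j) ∧
      (∀ j k, j < k → R (n j) k (m k) (n k)) ∧
      ∀ i, ∃ y : H, ∀ j k, j < k → i ≤ k →
        |inner ℝ (x i (n j) - y) (x i (n k) - y)| ≤ (1 / 4) ^ k := by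
  set U : Ultrafilter ℕ := hyperfilter ℕ with hU
  have hUtop : (U : Filter ℕ) ≤ atTop := Nat.hyperfilter_le_atTop
  have hFl : ∀ i, ∃ l, Tendsto (fun n => F n i) U (𝓝 l) := by
    intro i
    obtain ⟨l, -, hl⟩ := isCompact_Icc.ultrafilter_le_nhds (U.map fun n => F n i)
      (le_principal_iff.2 (Filter.mem_map.2 (Filter.univ_mem' fun n => hF n i)))
    exact ⟨l, hl⟩
  choose Fl hFl using hFl
  choose y hy using fun i => exists_tendsto_inner_of_bounded U (hx i)
  choose m₀ hm₀ using hR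
  have hw : ∀ i n, Tendsto (fun n' => inner ℝ (x i n - y i) (x i n' - y i)) U (𝓝 0) := by
    intro i n
    have := (hy i (x i n - y i)).sub_const (inner ℝ (y i) (x i n - y i))
    rw [sub_self] at this
    refine this.congr fun n' => ?_
    rw [← inner_sub_left, real_inner_comm]
  obtain ⟨s, hs1, hs2⟩ := exists_seq_of_forall_finset_exists
    (fun s : ℕ × ℕ × ℕ => 4 ^ s.1 ≤ s.2.2 ∧
      ∀ i, i ≤ s.2.2 → |F s.2.1 i - Fl i| ≤ (1 / 4) ^ s.1)
    (fun s t => s.1 < t.1 ∧ s.2.1 < t.2.1 ∧ R s.2.1 t.1 t.2.2 t.2.1 ∧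
      ∀ i, i ≤ t.1 → |inner ℝ (x i s.2.1 - y i) (x i t.2.1 - y i)| ≤ (1 / 4) ^ t.1) (by
    intro S _
    set k := S.sup (fun s => s.1) + 1 with hk
    set m := max (4 ^ k) (S.sup fun s => m₀ s.2.1 k) with hm
    have hpos : (0 : ℝ) < (1 / 4) ^ k := by positivity
    have e1 : ∀ᶠ n in (U : Filter ℕ), ∀ i ∈ Finset.range (m + 1), |F n i - Fl i| ≤ (1 / 4) ^ k := by
      refine (eventually_all_finset _).2 fun i _ => ?_
      have := ((hFl i).sub_const (Fl i)).abs
      rw [sub_self, abs_zero] at this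
      exact this.eventually_le_const hpos
    have e2 : ∀ᶠ n in (U : Filter ℕ), ∀ s ∈ S, s.2.1 < n :=
      (eventually_all_finset _).2 fun s _ => hUtop (eventually_gt_atTop _)
    have e3 : ∀ᶠ n in (U : Filter ℕ), ∀ s ∈ S, ∀ i ∈ Finset.range (k + 1),
        |inner ℝ (x i s.2.1 - y i) (x i n - y i)| ≤ (1 / 4) ^ k := by
      refine (eventually_all_finset _).2 fun s _ => (eventually_all_finset _).2 fun i _ => ?_
      have := (hw i s.2.1).abs
      rw [abs_zero] at this
      exact this.eventually_le_const hpos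
    obtain ⟨n, h1, h2, h3⟩ := (e1.and (e2.and e3)).exists
    refine ⟨(k, n, m), ⟨le_max_left _ _, fun i hi =>
      h1 i (Finset.mem_range.2 (Nat.lt_succ_of_le hi))⟩,
      fun s hs => ⟨?_, h2 s hs, ?_, fun i hi => h3 s hs i
        (Finset.mem_range.2 (Nat.lt_succ_of_le hi))⟩⟩
    · exact Nat.lt_succ_of_le (Finset.le_sup (f := fun s : ℕ × ℕ × ℕ => s.1) hs)
    · exact hm₀ _ _ _ ((Finset.le_sup (f := fun s : ℕ × ℕ × ℕ => m₀ s.2.1 k) hs).trans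
        (le_max_right _ _)) _)
  have hk : ∀ j, j ≤ (s j).1 := fun j => (strictMono_nat_of_lt_succ fun j =>
    (hs2 j (j + 1) (Nat.lt_succ_self j)).1).le_apply
  have hpow : ∀ j, ((1 : ℝ) / 4) ^ (s j).1 ≤ (1 / 4) ^ j := fun j =>
    pow_le_pow_of_le_one (by norm_num) (by norm_num) (hk j)
  refine ⟨fun j => (s j).2.1, fun j => (s j).2.2, Fl, strictMono_nat_of_lt_succ fun j =>
    (hs2 j (j + 1) (Nat.lt_succ_self j)).2.1, fun j => ?_, hFl, fun j i hi => ?_,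
    fun j k hjk => ?_, fun i => ⟨y i, fun j k hjk hik => ?_⟩⟩
  · exact (Nat.pow_le_pow_right (by norm_num) (hk j)).trans (hs1 j).1
  · exact ((hs1 j).2 i hi).trans (hpow j)
  · exact hRmono _ _ _ _ _ (hk k) (hs2 j k hjk).2.2.1
  · exact ((hs2 j k hjk).2.2.2 i (hik.trans (hk k))).trans (hpow k)

end Selection

section RarePart

lemma tendsto_zero_of_forall_le_ofReal {ι : Type*} {l : Filter ι} {f : ι → ℝ≥0∞}
    (h : ∀ δ : ℝ, 0 < δ → ∀ᶠ n in l, f n ≤ ENNReal.ofReal δ) : Tendsto f l (𝓝 0) := by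
  refine ENNReal.tendsto_nhds_zero.2 fun ε hε => ?_
  rcases eq_or_ne ε ⊤ with rfl | ht
  · exact Eventually.of_forall fun _ => le_top
  · have := h ε.toReal (ENNReal.toReal_pos hε.ne' ht)
    rwa [ENNReal.ofReal_toReal ht] at this

variable {Ψ : ℝ → ℝ}

lemma IsYoung.map_sum_div_le (hΨ : IsYoung Ψ) (v : ℕ → ℝ) {n M : ℕ} (h : n ≤ M) :
    Ψ ((∑ j ∈ Finset.range n, v j) / M) ≤ (∑ j ∈ Finset.range n, Ψ (v j)) / M := by
  rcases Nat.eq_zero_or_pos M with rfl | hM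
  · simp [hΨ.map_zero]
  set w : ℕ → ℝ := fun j => if j < n then v j else 0 with hw
  have hM' : (M : ℝ) ≠ 0 := by exact_mod_cast hM.ne'
  have h1 := hΨ.convexOn.map_sum_le (t := Finset.range M) (w := fun _ => (M : ℝ)⁻¹) (p := w)
    (fun _ _ => by positivity) (by simp [hM']) (fun _ _ => mem_univ _)
  have h2 : ∀ g : ℝ → ℝ, g 0 = 0 →
      ∑ j ∈ Finset.range M, (M : ℝ)⁻¹ • g (w j) = (∑ j ∈ Finset.range n, g (v j)) / M := by
    intro g hg
    rw [← Finset.smul_sum, smul_eq_mul, div_eq_inv_mul]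
    congr 1
    rw [← Finset.sum_subset (Finset.range_subset_range.2 h)
      (fun j _ hj => by simp [hw, Finset.mem_range.not.1 hj, hg])]
    exact Finset.sum_congr rfl fun j hj => by simp [hw, Finset.mem_range.1 hj]
  rw [h2 Ψ hΨ.map_zero] at h1
  have h3 := h2 id rfl
  simp only [id] at h3
  rwa [h3] at h1

lemma IsYoung.map_half_sum_div_le (hΨ : IsYoung Ψ) {s : Set ℕ} {v : ℕ → ℝ}
    (hv : ∀ k, k ∉ s → v k = 0) {n M : ℕ} (h : n ≤ M) :
    Ψ (1 / 2 * ((∑ j ∈ Finset.range n, v j) / M)) ≤ ∑ k ∈ Finset.range n,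
      s.indicator (fun k => Ψ (v k / M) + (∑ j ∈ Finset.range k, Ψ (v j)) / M) k := by
  induction n with
  | zero => simp [hΨ.map_zero]
  | succ n ih =>
    rw [Finset.sum_range_succ, Finset.sum_range_succ]
    by_cases hn : n ∈ s
    · rw [indicator_of_mem hn, add_div, mul_add]
      have h1 := hΨ.add_le ((∑ j ∈ Finset.range n, v j) / M) (v n / M)
        (by norm_num : (0 : ℝ) ≤ 1 / 2) (by norm_num : (0 : ℝ) ≤ 1 / 2) (by norm_num)
      have h2 := hΨ.map_sum_div_le v (Nat.le_of_succ_le h)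
      have h3 : 0 ≤ ∑ k ∈ Finset.range n,
          s.indicator (fun k => Ψ (v k / M) + (∑ j ∈ Finset.range k, Ψ (v j)) / M) k :=
        Finset.sum_nonneg fun k _ => indicator_nonneg (fun k _ => add_nonneg (hΨ.nonneg _)
          (div_nonneg (Finset.sum_nonneg fun _ _ => hΨ.nonneg _) (Nat.cast_nonneg _))) _
      have h4 := hΨ.nonneg (v n / M)
      have h5 := hΨ.nonneg ((∑ j ∈ Finset.range n, v j) / M)
      linarith
    · rw [indicator_of_notMem hn, hv n hn, add_zero, add_zero]
      exact ih (Nat.le_of_succ_le h)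

variable {Ω : Type*} [MeasurableSpace Ω] {P : Measure Ω}

/-- Cesàro means of the restrictions to rare events tend to zero in modular. -/
lemma tendsto_lintegral_half_cesaro_indicator (hΨ : IsYoung Ψ)
    (hnabla : ∃ D, 0 ≤ D ∧ ∀ ε > 0, ∃ N₀ : ℕ, ∀ N : ℕ, N₀ ≤ N → 0 < N →
      ∀ y, Ψ (y / N) ≤ ε / N * Ψ y + D)
    {ξ : ℕ → Ω → ℝ} (hξ : ∀ n, Measurable (ξ n))
    (hξ1 : ∀ n, ∫⁻ ω, ENNReal.ofReal (Ψ (ξ n ω)) ∂P ≤ 1)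
    {B : ℕ → Set Ω} (hB : ∀ k, MeasurableSet (B k))
    (hPB : ∀ k, P (B k) ≤ ENNReal.ofReal ((1 / 4) ^ k))
    (hBξ : ∀ j k, j < k →
      ∫⁻ ω in B k, ENNReal.ofReal (Ψ (ξ j ω)) ∂P ≤ ENNReal.ofReal ((1 / 4) ^ k)) :
    Tendsto (fun N => ∫⁻ ω, ENNReal.ofReal
      (Ψ (1 / 2 * cesaro (fun k => (B k).indicator fun ω => |ξ k ω|) N ω)) ∂P) atTop (𝓝 0) := by
  have hΨm : Measurable Ψ := hΨ.continuous.measurable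
  have hΨξ : ∀ k, Measurable fun ω => ENNReal.ofReal (Ψ (ξ k ω)) := fun k =>
    (hΨm.comp (hξ k)).ennreal_ofReal
  obtain ⟨D, hD, hnabla⟩ := hnabla
  set I : ℕ → ℕ → ℝ≥0∞ := fun M k => ∫⁻ ω in B k, ENNReal.ofReal (Ψ (ξ k ω / M)) ∂P with hI
  have hsum : ∀ N : ℕ, ∫⁻ ω, ENNReal.ofReal
      (Ψ (1 / 2 * cesaro (fun k => (B k).indicator fun ω => |ξ k ω|) N ω)) ∂P
      ≤ ∑ k ∈ Finset.range (N + 1),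
        (I (N + 1) k + ENNReal.ofReal ((1 / 2) ^ k / ((N + 1 : ℕ) : ℝ))) := by
    intro N
    have hM : (0 : ℝ) < ((N + 1 : ℕ) : ℝ) := by positivity
    have hpt : ∀ ω, ENNReal.ofReal
        (Ψ (1 / 2 * cesaro (fun k => (B k).indicator fun ω => |ξ k ω|) N ω))
        ≤ ∑ k ∈ Finset.range (N + 1), (B k).indicator (fun ω =>
          ENNReal.ofReal (Ψ (ξ k ω / (N + 1 : ℕ))) +
          ∑ j ∈ Finset.range k, ENNReal.ofReal (((N + 1 : ℕ) : ℝ)⁻¹) *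
            ENNReal.ofReal (Ψ (ξ j ω))) ω := by
      intro ω
      have h1 := hΨ.map_half_sum_div_le (s := {k | ω ∈ B k})
        (v := fun k => (B k).indicator (fun ω => |ξ k ω|) ω)
        (fun k hk => indicator_of_notMem (show ω ∉ B k from hk) _) (le_refl (N + 1))
      have h2 : cesaro (fun k => (B k).indicator fun ω => |ξ k ω|) N ω
          = (∑ j ∈ Finset.range (N + 1), (B j).indicator (fun ω => |ξ j ω|) ω)
            / ((N + 1 : ℕ) : ℝ) := by
        simp [cesaro]
      rw [h2]
      refine (ENNReal.ofReal_le_ofReal h1).trans ?_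
      refine (ENNReal.ofReal_sum_of_nonneg fun k _ => indicator_nonneg (fun k _ =>
        add_nonneg (hΨ.nonneg _) (div_nonneg (Finset.sum_nonneg fun _ _ => hΨ.nonneg _)
          (Nat.cast_nonneg _))) _).trans_le ?_
      refine Finset.sum_le_sum fun k _ => ?_
      by_cases hk : ω ∈ B k
      · rw [indicator_of_mem (show k ∈ {k | ω ∈ B k} from hk), indicator_of_mem hk,
          indicator_of_mem hk]
        refine ENNReal.ofReal_add_le.trans (add_le_add (le_of_eq ?_) ?_)
        · rw [← hΨ.map_abs (ξ k ω / _), abs_div, Nat.abs_cast]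
        · rw [← Finset.mul_sum, div_eq_inv_mul, ENNReal.ofReal_mul (by positivity)]
          gcongr
          rw [ENNReal.ofReal_sum_of_nonneg fun _ _ => hΨ.nonneg _]
          refine Finset.sum_le_sum fun j _ => ENNReal.ofReal_le_ofReal (hΨ.mono ?_)
          by_cases hj : ω ∈ B j
          · rw [indicator_of_mem hj, abs_abs]
          · rw [indicator_of_notMem hj, abs_zero]; exact abs_nonneg _
      · rw [indicator_of_notMem (show k ∉ {k | ω ∈ B k} from hk)]
        simp
    refine (lintegral_mono hpt).trans ?_
    have hm1 : ∀ k, Measurable fun ω => ENNReal.ofReal (Ψ (ξ k ω / ((N + 1 : ℕ) : ℝ))) :=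
      fun k => (hΨm.comp ((hξ k).div_const _)).ennreal_ofReal
    have hm2 : ∀ k, Measurable fun ω => ENNReal.ofReal (((N + 1 : ℕ) : ℝ)⁻¹) *
        ENNReal.ofReal (Ψ (ξ k ω)) :=
      fun k => (hΨξ k).const_mul _
    have hm3 : ∀ k, Measurable fun ω => ENNReal.ofReal (Ψ (ξ k ω / ((N + 1 : ℕ) : ℝ))) +
        ∑ j ∈ Finset.range k, ENNReal.ofReal (((N + 1 : ℕ) : ℝ)⁻¹) * ENNReal.ofReal (Ψ (ξ j ω)) :=
      fun k => (hm1 k).add (Finset.measurable_fun_sum _ fun j _ => hm2 j)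
    rw [lintegral_finsetSum _ fun k _ => (hm3 k).indicator (hB k)]
    refine Finset.sum_le_sum fun k _ => ?_
    rw [lintegral_indicator (hB k), lintegral_add_left (hm1 k)]
    refine add_le_add le_rfl ?_
    rw [lintegral_finsetSum _ fun j _ => hm2 j]
    have h3 : ∀ j ∈ Finset.range k, ∫⁻ ω in B k, ENNReal.ofReal (((N + 1 : ℕ) : ℝ)⁻¹) *
        ENNReal.ofReal (Ψ (ξ j ω)) ∂P ≤ ENNReal.ofReal (((N + 1 : ℕ) : ℝ)⁻¹ * (1 / 4) ^ k) := by
      intro j hj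
      rw [lintegral_const_mul _ (hΨξ j),
        ENNReal.ofReal_mul (by positivity)]
      gcongr
      exact hBξ j k (Finset.mem_range.1 hj)
    refine (Finset.sum_le_sum h3).trans ?_
    rw [Finset.sum_const, Finset.card_range, nsmul_eq_mul, ← ENNReal.ofReal_natCast,
      ← ENNReal.ofReal_mul (Nat.cast_nonneg _)]
    refine ENNReal.ofReal_le_ofReal ?_
    have h4 : (k : ℝ) ≤ 2 ^ k := by exact_mod_cast (Nat.lt_two_pow_self (n := k)).le
    calc (k : ℝ) * (((N + 1 : ℕ) : ℝ)⁻¹ * (1 / 4) ^ k)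
        ≤ 2 ^ k * (((N + 1 : ℕ) : ℝ)⁻¹ * (1 / 4) ^ k) := by gcongr
      _ = (2 * (1 / 4)) ^ k / ((N + 1 : ℕ) : ℝ) := by rw [mul_pow]; ring
      _ = (1 / 2) ^ k / ((N + 1 : ℕ) : ℝ) := by norm_num
  refine tendsto_zero_of_forall_le_ofReal fun δ hδ => ?_
  obtain ⟨K, hK⟩ : ∃ K : ℕ, 2 * D * (1 / 2) ^ K ≤ δ / 4 := by
    have : Tendsto (fun K : ℕ => 2 * D * (1 / 2 : ℝ) ^ K) atTop (𝓝 0) := by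
      simpa using (tendsto_pow_atTop_nhds_zero_of_lt_one (by norm_num : (0 : ℝ) ≤ 1 / 2)
        (by norm_num)).const_mul (2 * D)
    exact (this.eventually_le_const (by positivity)).exists
  obtain ⟨N₀, hN₀⟩ := hnabla (δ / 4) (by positivity)
  have hlim : Tendsto (fun N : ℕ => (2 * 2 ^ K + 2) * (1 / ((N : ℝ) + 1))) atTop (𝓝 0) := by
    simpa using (tendsto_one_div_add_atTop_nhds_zero_nat (𝕜 := ℝ)).const_mul (2 * 2 ^ K + 2)
  filter_upwards [eventually_ge_atTop N₀, hlim.eventually_le_const (by positivity : 0 < δ / 4)]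
    with N hN hNδ
  set M : ℝ := ((N + 1 : ℕ) : ℝ) with hM
  have hM0 : 0 < M := by positivity
  have hM1 : 1 ≤ M := by rw [hM]; exact_mod_cast Nat.le_add_left 1 N
  have hIle : ∀ k, I (N + 1) k ≤
      ENNReal.ofReal (2 ^ K / M * (1 / 2) ^ k + δ / 4 / M + D * (1 / 2) ^ K * (1 / 2) ^ k) := by
    intro k
    rcases le_total k K with hk | hk
    · have h1 : I (N + 1) k ≤ ENNReal.ofReal M⁻¹ := by
        calc I (N + 1) k ≤ ∫⁻ ω, ENNReal.ofReal (Ψ (ξ k ω / M)) ∂P := setLIntegral_le_lintegral _ _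
          _ ≤ ∫⁻ ω, ENNReal.ofReal M⁻¹ * ENNReal.ofReal (Ψ (ξ k ω)) ∂P := by
            refine lintegral_mono fun ω => ?_
            rw [← ENNReal.ofReal_mul (by positivity), div_eq_inv_mul]
            exact ENNReal.ofReal_le_ofReal
              (hΨ.map_mul_le (by positivity) (inv_le_one_of_one_le₀ hM1) _)
          _ = ENNReal.ofReal M⁻¹ * ∫⁻ ω, ENNReal.ofReal (Ψ (ξ k ω)) ∂P :=
            lintegral_const_mul _ (hΨξ k)
          _ ≤ ENNReal.ofReal M⁻¹ := mul_le_of_le_one_right zero_le (hξ1 k)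
      refine h1.trans (ENNReal.ofReal_le_ofReal ?_)
      have h2 : (1 : ℝ) ≤ 2 ^ K * (1 / 2) ^ k := by
        rw [one_div, inv_pow, ← div_eq_mul_inv, le_div_iff₀ (by positivity), one_mul]
        exact pow_le_pow_right₀ (by norm_num) hk
      calc M⁻¹ ≤ (2 ^ K * (1 / 2) ^ k) * M⁻¹ := le_mul_of_one_le_left (by positivity) h2
        _ = 2 ^ K / M * (1 / 2) ^ k := by ring
        _ ≤ _ := by
          have h3 : 0 ≤ δ / 4 / M := by positivity
          have h4 : 0 ≤ D * (1 / 2) ^ K * (1 / 2) ^ k := by positivity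
          linarith
    · have h1 : I (N + 1) k ≤ ENNReal.ofReal (δ / 4 / M) + ENNReal.ofReal (D * (1 / 4) ^ k) := by
        calc I (N + 1) k ≤ ∫⁻ ω in B k, (ENNReal.ofReal (δ / 4 / M) * ENNReal.ofReal (Ψ (ξ k ω))
              + ENNReal.ofReal D) ∂P := by
              refine lintegral_mono fun ω => ?_
              rw [← ENNReal.ofReal_mul (by positivity),
                ← ENNReal.ofReal_add (mul_nonneg (by positivity) (hΨ.nonneg _)) hD]
              exact ENNReal.ofReal_le_ofReal (hN₀ (N + 1) (by omega) (by omega) _)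
          _ = ENNReal.ofReal (δ / 4 / M) * ∫⁻ ω in B k, ENNReal.ofReal (Ψ (ξ k ω)) ∂P
              + ENNReal.ofReal D * P (B k) := by
              rw [lintegral_add_right _ measurable_const,
                lintegral_const_mul _ (hΨξ k), setLIntegral_const]
          _ ≤ _ := by
              refine add_le_add (mul_le_of_le_one_right zero_le
                ((setLIntegral_le_lintegral _ _).trans (hξ1 k))) ?_
              rw [ENNReal.ofReal_mul hD]
              gcongr
              exact hPB k
      refine h1.trans ?_
      rw [← ENNReal.ofReal_add (by positivity) (by positivity)]
      refine ENNReal.ofReal_le_ofReal ?_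
      have h2 : ((1 : ℝ) / 4) ^ k ≤ (1 / 2) ^ K * (1 / 2) ^ k := by
        rw [show (1 : ℝ) / 4 = 1 / 2 * (1 / 2) by norm_num, mul_pow]
        gcongr ?_ * _
        exact pow_le_pow_of_le_one (by norm_num) (by norm_num) hk
      have h3 : D * (1 / 4) ^ k ≤ D * ((1 / 2) ^ K * (1 / 2) ^ k) := by gcongr
      have h4 : 0 ≤ 2 ^ K / M * (1 / 2) ^ k := by positivity
      linarith
  refine (hsum N).trans ((Finset.sum_le_sum fun k _ => add_le_add (hIle k) le_rfl).trans ?_)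
  have hgeo := sum_geometric_two_le (N + 1)
  have hadd : ∀ k, ENNReal.ofReal (2 ^ K / M * (1 / 2) ^ k + δ / 4 / M +
      D * (1 / 2) ^ K * (1 / 2) ^ k) + ENNReal.ofReal ((1 / 2) ^ k / M)
      = ENNReal.ofReal ((2 ^ K / M + D * (1 / 2) ^ K + 1 / M) * (1 / 2) ^ k + δ / 4 / M) := by
    intro k
    rw [← ENNReal.ofReal_add (by positivity) (by positivity)]
    congr 1
    ring
  rw [Finset.sum_congr rfl fun k _ => hadd k,
    ← ENNReal.ofReal_sum_of_nonneg fun k _ => by positivity]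
  refine ENNReal.ofReal_le_ofReal ?_
  rw [Finset.sum_add_distrib, ← Finset.mul_sum, Finset.sum_const, Finset.card_range, nsmul_eq_mul]
  have h5 : (2 ^ K / M + D * (1 / 2) ^ K + 1 / M) * ∑ k ∈ Finset.range (N + 1), (1 / 2 : ℝ) ^ k
      ≤ (2 ^ K / M + D * (1 / 2) ^ K + 1 / M) * 2 := by gcongr
  have h6 : ((N + 1 : ℕ) : ℝ) * (δ / 4 / M) = δ / 4 := mul_div_cancel₀ _ hM0.ne'
  have h7 : (2 * 2 ^ K + 2) * (1 / ((N : ℝ) + 1)) = 2 ^ K / M * 2 + 1 / M * 2 := by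
    rw [hM]; push_cast; ring
  rw [h6]
  linarith

end RarePart

section CesaroModular

variable {Ω : Type*} [MeasurableSpace Ω] {P : Measure Ω} {Ψ : ℝ → ℝ}

lemma IsYoung.exists_lintegral_sub_clamp_le (hΨ : IsYoung Ψ) {ξ : ℕ → Ω → ℝ}
    (hξ : ∀ n, Measurable (ξ n)) (hξ1 : ∀ n, ∫⁻ ω, ENNReal.ofReal (Ψ (ξ n ω)) ∂P ≤ 1)
    {ε : ℝ≥0∞} (hε : 0 < ε) :
    ∃ i : ℕ, ∀ n, ∫⁻ ω, ENNReal.ofReal |ξ n ω - clamp i (ξ n ω)| ∂P ≤ ε := by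
  obtain ⟨δ, hδ0, hδε⟩ : ∃ δ : ℝ, 0 < δ ∧ ENNReal.ofReal δ ≤ ε := by
    rcases eq_or_ne ε ⊤ with rfl | ht
    · exact ⟨1, one_pos, le_top⟩
    · exact ⟨ε.toReal, ENNReal.toReal_pos hε.ne' ht, (ENNReal.ofReal_toReal ht).le⟩
  obtain ⟨R, hR0, hR⟩ := hΨ.exists_linear_le δ⁻¹
  obtain ⟨i, hi⟩ := exists_nat_ge R
  refine ⟨i, fun n => le_trans ?_ hδε⟩
  calc ∫⁻ ω, ENNReal.ofReal |ξ n ω - clamp i (ξ n ω)| ∂P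
      ≤ ∫⁻ ω, ENNReal.ofReal δ * ENNReal.ofReal (Ψ (ξ n ω)) ∂P := by
        refine lintegral_mono fun ω => ?_
        rw [← ENNReal.ofReal_mul hδ0.le]
        refine ENNReal.ofReal_le_ofReal ?_
        rcases le_total |ξ n ω| i with h | h
        · rw [clamp_of_abs_le h, sub_self, abs_zero]
          exact mul_nonneg hδ0.le (hΨ.nonneg _)
        · refine (abs_sub_clamp_le (Nat.cast_nonneg i) _).trans ?_
          have := hR (ξ n ω) (hi.trans h)
          rwa [inv_mul_le_iff₀ hδ0] at this
    _ = ENNReal.ofReal δ * ∫⁻ ω, ENNReal.ofReal (Ψ (ξ n ω)) ∂P :=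
        lintegral_const_mul _ (hΨ.continuous.measurable.comp (hξ n)).ennreal_ofReal
    _ ≤ ENNReal.ofReal δ := mul_le_of_le_one_right zero_le (hξ1 n)

lemma IsYoung.memLp_one [IsFiniteMeasure P] (hΨ : IsYoung Ψ) {f : Ω → ℝ} (hf : Measurable f)
    (h : ∫⁻ ω, ENNReal.ofReal (Ψ (f ω)) ∂P ≤ 1) : MemLp f 1 P := by
  refine ⟨hf.aestronglyMeasurable, ?_⟩
  obtain ⟨R, hR0, hR⟩ := hΨ.exists_linear_le 1
  rw [eLpNorm_one_eq_lintegral_enorm]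
  calc ∫⁻ ω, ‖f ω‖ₑ ∂P ≤ ∫⁻ ω, (ENNReal.ofReal (Ψ (f ω)) + ENNReal.ofReal R) ∂P := by
        refine lintegral_mono fun ω => ?_
        rw [Real.enorm_eq_ofReal_abs, ← ENNReal.ofReal_add (hΨ.nonneg _) hR0.le]
        refine ENNReal.ofReal_le_ofReal ?_
        have h1 := hΨ.nonneg (f ω)
        rcases le_total R |f ω| with h | h
        · linarith [hR _ h]
        · linarith
    _ = ∫⁻ ω, ENNReal.ofReal (Ψ (f ω)) ∂P + ENNReal.ofReal R * P univ := by
        rw [lintegral_add_right _ measurable_const, lintegral_const]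
    _ < ⊤ := ENNReal.add_lt_top.2 ⟨h.trans_lt ENNReal.one_lt_top,
        ENNReal.mul_lt_top ENNReal.ofReal_lt_top (measure_lt_top _ _)⟩

lemma exists_subseq_tendsto_ae_of_eLpNorm {f : ℕ → Ω → ℝ} {g : Ω → ℝ} (hf : ∀ n, Measurable (f n))
    (hg : Measurable g) (h : Tendsto (fun n => eLpNorm (f n - g) 1 P) atTop (𝓝 0)) :
    ∃ ns : ℕ → ℕ, StrictMono ns ∧ ∀ᵐ ω ∂P, Tendsto (fun i => f (ns i) ω) atTop (𝓝 (g ω)) :=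
  (tendstoInMeasure_of_tendsto_eLpNorm one_ne_zero (fun n => (hf n).aestronglyMeasurable)
    hg.aestronglyMeasurable h).exists_seq_tendsto_ae

lemma IsYoung.lintegral_limit_le_one (hΨ : IsYoung Ψ) {f : ℕ → Ω → ℝ} {g : Ω → ℝ}
    (hf : ∀ n, Measurable (f n)) (hg : Measurable g)
    (h : Tendsto (fun n => eLpNorm (f n - g) 1 P) atTop (𝓝 0))
    (hf1 : ∀ n, ∫⁻ ω, ENNReal.ofReal (Ψ (f n ω)) ∂P ≤ 1) :
    ∫⁻ ω, ENNReal.ofReal (Ψ (g ω)) ∂P ≤ 1 := by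
  obtain ⟨ns, -, hns⟩ := exists_subseq_tendsto_ae_of_eLpNorm hf hg h
  calc ∫⁻ ω, ENNReal.ofReal (Ψ (g ω)) ∂P
      = ∫⁻ ω, liminf (fun i => ENNReal.ofReal (Ψ (f (ns i) ω))) atTop ∂P := by
        refine lintegral_congr_ae ?_
        filter_upwards [hns] with ω hω
        exact (ENNReal.tendsto_ofReal ((hΨ.continuous.tendsto _).comp hω)).liminf_eq.symm
    _ ≤ liminf (fun i => ∫⁻ ω, ENNReal.ofReal (Ψ (f (ns i) ω)) ∂P) atTop :=
        lintegral_liminf_le fun i => (hΨ.continuous.measurable.comp (hf _)).ennreal_ofReal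
    _ ≤ 1 := liminf_le_of_le (by isBoundedDefault) fun b hb => by
        obtain ⟨i, hi⟩ := hb.exists
        exact hi.trans (hf1 _)

lemma IsYoung.tendsto_lintegral_min (hΨ : IsYoung Ψ) {f : ℕ → Ω → ℝ} {g : Ω → ℝ}
    (hf : ∀ n, Measurable (f n)) (hg : Measurable g)
    (h : Tendsto (fun n => eLpNorm (f n - g) 1 P) atTop (𝓝 0)) {φ : Ω → ℝ≥0∞}
    (hφ : Measurable φ) (hφi : ∫⁻ ω, φ ω ∂P ≠ ⊤) (c : ℝ) :
    Tendsto (fun n => ∫⁻ ω, min (ENNReal.ofReal (Ψ (c * (f n ω - g ω)))) (φ ω) ∂P)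
      atTop (𝓝 0) := by
  refine tendsto_of_subseq_tendsto fun ns hns => ?_
  obtain ⟨ms, -, hms⟩ := exists_subseq_tendsto_ae_of_eLpNorm (fun n => hf (ns n)) hg (h.comp hns)
  refine ⟨ms, ?_⟩
  have := tendsto_lintegral_of_dominated_convergence (μ := P) (f := fun _ => 0)
    (F := fun i ω => min (ENNReal.ofReal (Ψ (c * (f (ns (ms i)) ω - g ω)))) (φ ω)) φ
    (fun i => (hΨ.continuous.measurable.comp
      (((hf _).sub hg).const_mul c)).ennreal_ofReal.min hφ)
    (fun i => ae_of_all _ fun ω => min_le_right _ _) hφi ?_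
  · simpa using this
  · filter_upwards [hms] with ω hω
    have h1 : Tendsto (fun i => ENNReal.ofReal (Ψ (c * (f (ns (ms i)) ω - g ω)))) atTop (𝓝 0) := by
      have h2 := ENNReal.tendsto_ofReal
        ((hΨ.continuous.tendsto (c * (g ω - g ω))).comp ((hω.sub_const (g ω)).const_mul c))
      simpa [hΨ.map_zero] using h2
    exact tendsto_of_tendsto_of_tendsto_of_le_of_le tendsto_const_nhds h1
      (fun _ => zero_le) (fun _ => min_le_left _ _)

lemma IsYoung.map_cesaro_le {X : Type*} (hΨ : IsYoung Ψ) (f : ℕ → X → ℝ) (N : ℕ) (ω : X) :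
    Ψ (cesaro f N ω) ≤ cesaro (fun j ω => Ψ (f j ω)) N ω := by
  have := hΨ.map_sum_div_le (fun j => f j ω) (le_refl (N + 1))
  simpa [cesaro] using this

end CesaroModular

section CesaroModularLimit

variable {Ω : Type*} [MeasurableSpace Ω] {P : Measure Ω} {Ψ : ℝ → ℝ}

lemma IsYoung.map_quarter_le (hΨ : IsYoung Ψ) {d a b c : ℝ} (ha : 0 ≤ a) (hb : 0 ≤ b)
    (h : |d| ≤ a + b + |c|) : Ψ (1 / 4 * d) ≤ Ψ a + Ψ (1 / 2 * b) + Ψ c := by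
  have h0 := abs_nonneg c
  have h1 : Ψ (1 / 4 * d) ≤ Ψ (1 / 2 * (1 / 2 * a + 1 / 2 * |c|) + 1 / 2 * (1 / 2 * b)) := by
    refine hΨ.mono ?_
    rw [abs_mul, abs_of_nonneg (by positivity :
      0 ≤ 1 / 2 * (1 / 2 * a + 1 / 2 * |c|) + 1 / 2 * (1 / 2 * b)),
      abs_of_pos (by norm_num : (0 : ℝ) < 1 / 4)]
    linarith
  have h2 := hΨ.add_le (1 / 2 * a + 1 / 2 * |c|) (1 / 2 * b)
    (by norm_num : (0 : ℝ) ≤ 1 / 2) (by norm_num : (0 : ℝ) ≤ 1 / 2) (by norm_num)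
  have h3 := hΨ.add_le a |c|
    (by norm_num : (0 : ℝ) ≤ 1 / 2) (by norm_num : (0 : ℝ) ≤ 1 / 2) (by norm_num)
  rw [hΨ.map_abs] at h3
  linarith [hΨ.nonneg a, hΨ.nonneg c, hΨ.nonneg (1 / 2 * b)]

lemma IsYoung.tendsto_lintegral_quarter_cesaro_sub [IsProbabilityMeasure P] (hΨ : IsYoung Ψ)
    {ξ : ℕ → Ω → ℝ} (hξ : ∀ n, Measurable (ξ n)) {ξ₀ : Ω → ℝ} (hξ₀ : Measurable ξ₀)
    (hξ₀1 : ∫⁻ ω, ENNReal.ofReal (Ψ (ξ₀ ω)) ∂P ≤ 1)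
    (hlim : Tendsto (fun N => eLpNorm (cesaro ξ N - ξ₀) 1 P) atTop (𝓝 0)) {m : ℕ → ℕ}
    (hrare : Tendsto (fun N => ∫⁻ ω, ENNReal.ofReal (Ψ (1 / 2 * cesaro (fun k =>
      {ω | (m k : ℝ) < Ψ (ξ k ω)}.indicator fun ω => |ξ k ω|) N ω)) ∂P) atTop (𝓝 0))
    (hui : ∀ δ : ℝ, 0 < δ → ∃ i : ℕ, ∀ k,
      ∫⁻ ω in {ω | (i : ℝ) < Ψ (ξ k ω) ∧ Ψ (ξ k ω) ≤ m k}, ENNReal.ofReal (Ψ (ξ k ω)) ∂P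
        ≤ ENNReal.ofReal (δ + 2 * (1 / 4) ^ k)) :
    Tendsto (fun N => ∫⁻ ω, ENNReal.ofReal (Ψ (1 / 4 * (cesaro ξ N ω - ξ₀ ω))) ∂P)
      atTop (𝓝 0) := by
  have hΨm : Measurable Ψ := hΨ.continuous.measurable
  have hΨξ : ∀ k, Measurable fun ω => Ψ (ξ k ω) := fun k => hΨm.comp (hξ k)
  set W : ℕ → Ω → ℝ := fun N ω => Ψ (1 / 2 * cesaro (fun k =>
      {ω | (m k : ℝ) < Ψ (ξ k ω)}.indicator fun ω => |ξ k ω|) N ω) with hW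
  have hBm : ∀ k, MeasurableSet {ω | (m k : ℝ) < Ψ (ξ k ω)} := fun k =>
    measurableSet_lt measurable_const (hΨξ k)
  have hWm : ∀ N, Measurable (W N) := fun N => hΨm.comp ((measurable_cesaro
    (fun k => (measurable_abs.comp (hξ k)).indicator (hBm k)) N).const_mul _)
  refine tendsto_zero_of_forall_le_ofReal fun δ hδ => ?_
  obtain ⟨i, hi⟩ := hui (δ / 4) (by positivity)
  set S : ℕ → Set Ω := fun k => {ω | (i : ℝ) < Ψ (ξ k ω) ∧ Ψ (ξ k ω) ≤ m k} with hS
  have hSm : ∀ k, MeasurableSet (S k) := fun k =>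
    (measurableSet_lt measurable_const (hΨξ k)).inter (measurableSet_le (hΨξ k) measurable_const)
  set r : ℕ → Ω → ℝ := fun k => (S k).indicator fun ω => Ψ (ξ k ω) with hr
  have hrm : ∀ k, Measurable (r k) := fun k => (hΨξ k).indicator (hSm k)
  have hr0 : ∀ k ω, 0 ≤ r k ω := fun k ω => indicator_nonneg (fun _ _ => hΨ.nonneg _) _
  set φ : Ω → ℝ≥0∞ := fun ω => ENNReal.ofReal (i + Ψ (ξ₀ ω)) with hφ
  have hφm : Measurable φ := ((hΨm.comp hξ₀).const_add _).ennreal_ofReal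
  have hφi : ∫⁻ ω, φ ω ∂P ≠ ⊤ := by
    have : ∫⁻ ω, φ ω ∂P ≤ ∫⁻ ω, (ENNReal.ofReal i + ENNReal.ofReal (Ψ (ξ₀ ω))) ∂P :=
      lintegral_mono fun ω => ENNReal.ofReal_add_le
    refine ne_top_of_le_ne_top ?_ this
    rw [lintegral_add_left measurable_const, lintegral_const, measure_univ, mul_one]
    exact ENNReal.add_ne_top.2 ⟨ENNReal.ofReal_ne_top,
      ne_top_of_le_ne_top ENNReal.one_ne_top hξ₀1⟩
  have hpt : ∀ N ω, ENNReal.ofReal (Ψ (1 / 4 * (cesaro ξ N ω - ξ₀ ω)))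
      ≤ min (ENNReal.ofReal (Ψ (1 / 4 * (cesaro ξ N ω - ξ₀ ω)))) (φ ω)
        + (ENNReal.ofReal (cesaro r N ω) + ENNReal.ofReal (W N ω)) := by
    intro N ω
    have hN : (0 : ℝ) < (N : ℝ) + 1 := by positivity
    set v : ℕ → Ω → ℝ := fun k => {ω | (m k : ℝ) < Ψ (ξ k ω)}.indicator fun ω => |ξ k ω| with hv
    set u : ℕ → Ω → ℝ := fun k ω => |ξ k ω| - v k ω with hu
    have hv0 : ∀ k, 0 ≤ v k ω := fun k => indicator_nonneg (fun _ _ => abs_nonneg _) _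
    have hu0 : ∀ k, 0 ≤ u k ω := fun k => by
      by_cases hk : (m k : ℝ) < Ψ (ξ k ω)
      · simp [hu, hv, hk]
      · simp [hu, hv, hk]
    have hΨu : ∀ k, Ψ (u k ω) ≤ i + r k ω := by
      intro k
      by_cases hk : (m k : ℝ) < Ψ (ξ k ω)
      · have : u k ω = 0 := by simp [hu, hv, hk]
        rw [this, hΨ.map_zero]
        exact add_nonneg (Nat.cast_nonneg _) (hr0 k ω)
      · have h1 : u k ω = |ξ k ω| := by simp [hu, hv, hk]
        rw [h1, hΨ.map_abs]
        by_cases hik : (i : ℝ) < Ψ (ξ k ω)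
        · have : r k ω = Ψ (ξ k ω) := indicator_of_mem (show ω ∈ S k from ⟨hik, not_lt.1 hk⟩) _
          rw [this]
          exact le_add_of_nonneg_left (Nat.cast_nonneg _)
        · exact (not_lt.1 hik).trans (le_add_of_nonneg_right (hr0 k ω))
    have hces0 : ∀ f : ℕ → Ω → ℝ, (∀ k, 0 ≤ f k ω) → 0 ≤ cesaro f N ω := fun f hf =>
      div_nonneg (Finset.sum_nonneg fun k _ => hf k) hN.le
    have habs : |cesaro ξ N ω| ≤ cesaro u N ω + cesaro v N ω := by
      rw [cesaro, cesaro, cesaro, abs_div, abs_of_pos hN, ← add_div, ← Finset.sum_add_distrib]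
      gcongr
      refine (Finset.abs_sum_le_sum_abs _ _).trans (Finset.sum_le_sum fun k _ => ?_)
      simp [hu]
    have hmain := hΨ.map_quarter_le (d := cesaro ξ N ω - ξ₀ ω) (c := ξ₀ ω) (hces0 u hu0)
      (hces0 v hv0) ((abs_sub _ _).trans (by linarith))
    have hces : Ψ (cesaro u N ω) ≤ i + cesaro r N ω := by
      refine (hΨ.map_cesaro_le u N ω).trans ?_
      rw [cesaro, cesaro, div_le_iff₀ hN, add_mul, div_mul_cancel₀ _ hN.ne']
      refine (Finset.sum_le_sum fun k _ => hΨu k).trans ?_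
      rw [Finset.sum_add_distrib, Finset.sum_const, Finset.card_range, nsmul_eq_mul]
      push_cast
      linarith
    have hX : ENNReal.ofReal (Ψ (1 / 4 * (cesaro ξ N ω - ξ₀ ω)))
        ≤ φ ω + (ENNReal.ofReal (cesaro r N ω) + ENNReal.ofReal (W N ω)) := by
      rw [hφ, ← ENNReal.ofReal_add (hces0 r fun k => hr0 k ω) (hΨ.nonneg _),
        ← ENNReal.ofReal_add (add_nonneg (Nat.cast_nonneg _) (hΨ.nonneg _))
          (add_nonneg (hces0 r fun k => hr0 k ω) (hΨ.nonneg _))]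
      refine ENNReal.ofReal_le_ofReal ?_
      have : W N ω = Ψ (1 / 2 * cesaro v N ω) := rfl
      linarith
    rcases le_total (ENNReal.ofReal (Ψ (1 / 4 * (cesaro ξ N ω - ξ₀ ω)))) (φ ω) with h | h
    · rw [min_eq_left h]; exact le_self_add
    · rw [min_eq_right h]; exact hX
  have hrint : ∀ N : ℕ, ∫⁻ ω, ENNReal.ofReal (cesaro r N ω) ∂P
      ≤ ENNReal.ofReal (δ / 4 + 4 * (1 / ((N : ℝ) + 1))) := by
    intro N
    have hN : (0 : ℝ) < (N : ℝ) + 1 := by positivity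
    rw [lintegral_cesaro hrm hr0]
    have h1 : ∀ k, ∫⁻ ω, ENNReal.ofReal (r k ω) ∂P ≤ ENNReal.ofReal (δ / 4 + 2 * (1 / 2) ^ k) := by
      intro k
      have h2 : ∀ ω, ENNReal.ofReal (r k ω)
          = (S k).indicator (fun ω => ENNReal.ofReal (Ψ (ξ k ω))) ω := by
        intro ω
        by_cases hω : ω ∈ S k <;> simp [hr, hω]
      simp only [h2]
      rw [lintegral_indicator (hSm k)]
      refine (hi k).trans (ENNReal.ofReal_le_ofReal ?_)
      gcongr
      norm_num
    refine (ENNReal.div_le_div_right (Finset.sum_le_sum fun k _ => h1 k) _).trans ?_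
    rw [← ENNReal.ofReal_sum_of_nonneg fun k _ => by positivity, ← ENNReal.ofReal_div_of_pos hN]
    refine ENNReal.ofReal_le_ofReal ?_
    rw [div_le_iff₀ hN, Finset.sum_add_distrib, ← Finset.mul_sum, Finset.sum_const,
      Finset.card_range, nsmul_eq_mul, add_mul, mul_assoc 4, one_div_mul_cancel hN.ne']
    have h3 := sum_geometric_two_le (N + 1)
    push_cast
    linarith
  have hmin := hΨ.tendsto_lintegral_min (measurable_cesaro hξ) hξ₀ hlim hφm hφi (1 / 4)
  have h4 : Tendsto (fun N : ℕ => 4 * (1 / ((N : ℝ) + 1))) atTop (𝓝 0) := by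
    simpa using (tendsto_one_div_add_atTop_nhds_zero_nat (𝕜 := ℝ)).const_mul 4
  have hδ4 : 0 < δ / 4 := by positivity
  have hδ4' : 0 < ENNReal.ofReal (δ / 4) := ENNReal.ofReal_pos.2 hδ4
  filter_upwards [hmin.eventually_le_const hδ4', hrare.eventually_le_const hδ4',
    h4.eventually_le_const hδ4] with N h1 h2 h3
  refine (lintegral_mono (hpt N)).trans ?_
  have hminm : Measurable fun ω =>
      min (ENNReal.ofReal (Ψ (1 / 4 * (cesaro ξ N ω - ξ₀ ω)))) (φ ω) :=
    (hΨm.comp (((measurable_cesaro hξ N).sub hξ₀).const_mul _)).ennreal_ofReal.min hφm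
  rw [lintegral_add_left hminm, lintegral_add_left (measurable_cesaro hrm N).ennreal_ofReal]
  refine (add_le_add h1 (add_le_add (hrint N) h2)).trans ?_
  rw [← ENNReal.ofReal_add (by positivity) hδ4.le, ← ENNReal.ofReal_add hδ4.le (by positivity)]
  exact ENNReal.ofReal_le_ofReal (by linarith)

lemma IsYoung.measure_lt_le_inv (hΨ : IsYoung Ψ) {f : Ω → ℝ} (hf : Measurable f)
    (h : ∫⁻ ω, ENNReal.ofReal (Ψ (f ω)) ∂P ≤ 1) (m : ℕ) :
    P {ω | (m : ℝ) < Ψ (f ω)} ≤ (m : ℝ≥0∞)⁻¹ := by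
  rcases Nat.eq_zero_or_pos m with rfl | hm
  · simp
  have hm0 : (m : ℝ≥0∞) ≠ 0 := by exact_mod_cast hm.ne'
  rw [← one_div, ENNReal.le_div_iff_mul_le (Or.inl hm0) (Or.inl (ENNReal.natCast_ne_top m)),
    mul_comm]
  refine le_trans ?_ ((mul_meas_ge_le_lintegral
    (hΨ.continuous.measurable.comp hf).ennreal_ofReal m).trans h)
  refine mul_le_mul' le_rfl (measure_mono fun ω hω => ?_)
  change (m : ℝ≥0∞) ≤ ENNReal.ofReal (Ψ (f ω))
  rw [← ENNReal.ofReal_natCast]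
  exact ENNReal.ofReal_le_ofReal (le_of_lt hω)

/-- Banach–Saks property in modular form: under a growth condition on `Ψ`, a sequence in the
modular unit ball has a subsequence whose Cesàro means converge in mean and in modular. -/
theorem IsYoung.exists_subseq_tendsto_cesaro [IsProbabilityMeasure P] (hΨ : IsYoung Ψ)
    (hnabla : ∃ D, 0 ≤ D ∧ ∀ ε > 0, ∃ N₀ : ℕ, ∀ N : ℕ, N₀ ≤ N → 0 < N →
      ∀ y, Ψ (y / N) ≤ ε / N * Ψ y + D)
    {ξ : ℕ → Ω → ℝ} (hξ : ∀ n, Measurable (ξ n))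
    (hξ1 : ∀ n, ∫⁻ ω, ENNReal.ofReal (Ψ (ξ n ω)) ∂P ≤ 1) :
    ∃ n : ℕ → ℕ, StrictMono n ∧ ∃ ξ₀ : Ω → ℝ, Measurable ξ₀ ∧
      ∫⁻ ω, ENNReal.ofReal (Ψ (ξ₀ ω)) ∂P ≤ 1 ∧
      Tendsto (fun N => eLpNorm (cesaro (fun j => ξ (n j)) N - ξ₀) 1 P) atTop (𝓝 0) ∧
      Tendsto (fun N => ∫⁻ ω, ENNReal.ofReal
        (Ψ (1 / 4 * (cesaro (fun j => ξ (n j)) N ω - ξ₀ ω))) ∂P) atTop (𝓝 0) := by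
  have hΨm : Measurable Ψ := hΨ.continuous.measurable
  have hΨξ : ∀ k, Measurable fun ω => Ψ (ξ k ω) := fun k => hΨm.comp (hξ k)
  set I : ℕ → ℕ → ℝ≥0∞ := fun n i =>
    ∫⁻ ω in {ω | Ψ (ξ n ω) ≤ i}, ENNReal.ofReal (Ψ (ξ n ω)) ∂P with hI
  have hI1 : ∀ n i, I n i ≤ 1 := fun n i => (setLIntegral_le_lintegral _ _).trans (hξ1 n)
  have hIt : ∀ n i, I n i ≠ ⊤ := fun n i => ne_top_of_le_ne_top ENNReal.one_ne_top (hI1 n i)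
  have hF : ∀ n i, (I n i).toReal ∈ Icc (0 : ℝ) 1 := fun n i =>
    ⟨ENNReal.toReal_nonneg, ENNReal.toReal_le_of_le_ofReal zero_le_one (by simpa using hI1 n i)⟩
  have hclm : ∀ i n : ℕ, Measurable fun ω => clamp i (ξ n ω) := fun i n =>
    (measurable_clamp i).comp (hξ n)
  have hclp : ∀ i n : ℕ, MemLp (fun ω => clamp i (ξ n ω)) 2 P := fun i n =>
    MemLp.of_bound (hclm i n).aestronglyMeasurable i
      (ae_of_all _ fun ω => abs_clamp_le (Nat.cast_nonneg i) _)
  set x : ℕ → ℕ → Lp ℝ 2 P := fun i n => (hclp i n).toLp _ with hx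
  have hxC : ∀ i n, ‖x i n‖ ≤ (measureUnivNNReal P : ℝ) ^ (2 : ℝ≥0∞).toReal⁻¹ * i := by
    intro i n
    refine Lp.norm_le_of_ae_bound (Nat.cast_nonneg i) ?_
    filter_upwards [(hclp i n).coeFn_toLp] with ω hω
    rw [hx, hω]
    exact abs_clamp_le (Nat.cast_nonneg i) _
  obtain ⟨n, m, Fl, hn, hm, hFl, hFm, hR, hinner⟩ := exists_selection hF hxC
    (R := fun n k m n' => ∫⁻ ω in {ω | (m : ℝ) < Ψ (ξ n' ω)}, ENNReal.ofReal (Ψ (ξ n ω)) ∂P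
      ≤ ENNReal.ofReal ((1 / 4) ^ k))
    (by
      intro n k
      obtain ⟨δ, hδ, hδs⟩ := exists_pos_setLIntegral_lt_of_measure_lt
        (ne_top_of_le_ne_top ENNReal.one_ne_top (hξ1 n))
        (ENNReal.ofReal_pos.2 (by positivity : (0 : ℝ) < (1 / 4) ^ k)).ne'
      obtain ⟨m₀, hm₀⟩ := ENNReal.exists_inv_nat_lt hδ.ne'
      refine ⟨m₀, fun m hm n' => (hδs _ ?_).le⟩
      refine (hΨ.measure_lt_le_inv (hξ n') (hξ1 n') m).trans_lt (lt_of_le_of_lt ?_ hm₀)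
      exact ENNReal.inv_le_inv.2 (by exact_mod_cast hm))
    (fun n k k' m n' hk h => h.trans (ENNReal.ofReal_le_ofReal
      (pow_le_pow_of_le_one (by norm_num) (by norm_num) hk)))
  have htrunc : ∀ i : ℕ, ∃ y : Ω → ℝ, MemLp y 2 P ∧ Tendsto (fun N =>
      eLpNorm (cesaro (fun j ω => clamp i (ξ (n j) ω)) N - y) 2 P) atTop (𝓝 0) := by
    intro i
    obtain ⟨y, hy⟩ := hinner i
    refine ⟨y, Lp.memLp y, ?_⟩
    have h1 := tendsto_cesaro_zero_of_inner (w := fun j => x i (n j) - y)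
      (fun j => (norm_sub_le _ _).trans (add_le_add_left (hxC i (n j)) ‖y‖)) hy
    have h2 : Tendsto (fun N => (memLp_cesaro (fun j => hclp i (n j)) N).toLp _) atTop (𝓝 y) := by
      rw [← tendsto_sub_nhds_zero_iff]
      refine h1.congr fun N => ?_
      rw [Finset.sum_sub_distrib, smul_sub, ← smul_sum_toLp, Finset.sum_const, Finset.card_range,
        ← Nat.cast_smul_eq_nsmul ℝ, smul_smul]
      push_cast
      rw [inv_mul_cancel₀ (by positivity), one_smul]
    refine (Lp.tendsto_Lp_iff_tendsto_eLpNorm' _ y).1 h2 |>.congr fun N => ?_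
    refine eLpNorm_congr_ae ?_
    filter_upwards [(memLp_cesaro (fun j => hclp i (n j)) N).coeFn_toLp] with ω hω
    simp only [Pi.sub_apply, hω]
  have hξn : ∀ j, Measurable (ξ (n j)) := fun j => hξ (n j)
  have hξn1 : ∀ j, ∫⁻ ω, ENNReal.ofReal (Ψ (ξ (n j) ω)) ∂P ≤ 1 := fun j => hξ1 (n j)
  obtain ⟨ξ₀, hξ₀, hlim⟩ := exists_tendsto_cesaro hξn (fun j => hΨ.memLp_one (hξn j) (hξn1 j))
    (fun ε hε => hΨ.exists_lintegral_sub_clamp_le hξn hξn1 hε) htrunc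
  have hξ₀1 : ∫⁻ ω, ENNReal.ofReal (Ψ (ξ₀ ω)) ∂P ≤ 1 := by
    refine hΨ.lintegral_limit_le_one (measurable_cesaro hξn) hξ₀ hlim fun N => ?_
    refine le_trans (lintegral_mono fun ω =>
      ENNReal.ofReal_le_ofReal (hΨ.map_cesaro_le (fun j => ξ (n j)) N ω)) ?_
    exact lintegral_cesaro_le (fun j => hΨm.comp (hξn j)) (fun j ω => hΨ.nonneg _) hξn1 N
  refine ⟨n, hn, ξ₀, hξ₀, hξ₀1, hlim,
    hΨ.tendsto_lintegral_quarter_cesaro_sub hξn hξ₀ hξ₀1 hlim (m := m) ?_ ?_⟩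
  · refine tendsto_lintegral_half_cesaro_indicator hΨ hnabla hξn hξn1
      (fun k => measurableSet_lt measurable_const (hΨξ (n k))) (fun k => ?_) hR
    refine (hΨ.measure_lt_le_inv (hξn k) (hξn1 k) (m k)).trans ?_
    rw [one_div, inv_pow, ENNReal.ofReal_inv_of_pos (by positivity)]
    refine ENNReal.inv_le_inv.2 ?_
    rw [← ENNReal.ofReal_natCast]
    exact ENNReal.ofReal_le_ofReal (by exact_mod_cast hm k)
  · intro δ hδ
    have hFlb : BddAbove (range Fl) := ⟨1, by
      rintro _ ⟨i, rfl⟩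
      exact le_of_tendsto (hFl i) (Eventually.of_forall fun k => (hF k i).2)⟩
    obtain ⟨i, hi⟩ := exists_lt_of_lt_ciSup (sub_lt_self (⨆ i, Fl i) hδ)
    refine ⟨i, fun k => ?_⟩
    rcases lt_or_ge (m k) i with hmi | hmi
    · have : {ω | (i : ℝ) < Ψ (ξ (n k) ω) ∧ Ψ (ξ (n k) ω) ≤ m k} = ∅ := by
        ext ω
        simp only [mem_ofPred_eq, mem_empty_iff_false, iff_false, not_and, not_le]
        exact fun h => lt_trans (by exact_mod_cast hmi) h
      simp [this]
    · set J := ∫⁻ ω in {ω | (i : ℝ) < Ψ (ξ (n k) ω) ∧ Ψ (ξ (n k) ω) ≤ m k},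
        ENNReal.ofReal (Ψ (ξ (n k) ω)) ∂P with hJ
      have hsplit : I (n k) (m k) = I (n k) i + J := by
        have hSm : MeasurableSet {ω | (i : ℝ) < Ψ (ξ (n k) ω) ∧ Ψ (ξ (n k) ω) ≤ m k} :=
          (measurableSet_lt measurable_const (hΨξ (n k))).inter
            (measurableSet_le (hΨξ (n k)) measurable_const)
        simp only [hI, hJ]
        rw [← lintegral_union hSm]
        · congr 2
          ext ω
          have him : (i : ℝ) ≤ m k := by exact_mod_cast hmi
          simp only [mem_ofPred_eq, mem_union]
          constructor
          · intro h
            rcases le_or_gt (Ψ (ξ (n k) ω)) i with h' | h'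
            · exact Or.inl h'
            · exact Or.inr ⟨h', h⟩
          · rintro (h | h)
            · exact h.trans him
            · exact h.2
        · exact Set.disjoint_left.2 fun ω (h : Ψ (ξ (n k) ω) ≤ i) h' => absurd h'.1 (not_lt.2 h)
      have hJt : J ≠ ⊤ := ne_top_of_le_ne_top (hIt (n k) (m k)) (hsplit ▸ le_add_self)
      have hreal : (I (n k) (m k)).toReal = (I (n k) i).toReal + J.toReal := by
        rw [hsplit, ENNReal.toReal_add (hIt _ _) hJt]
      rw [← ENNReal.ofReal_toReal hJt]
      refine ENNReal.ofReal_le_ofReal ?_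
      have h1 := abs_le.1 (hFm k (m k) le_rfl)
      have h2 := abs_le.1 (hFm k i hmi)
      have h3 := le_ciSup hFlb (m k)
      linarith [h1.1, h1.2, h2.1, h2.2]

end CesaroModularLimit

section MackeyConvergence

variable {Ω : Type*} [MeasurableSpace Ω] {P : Measure Ω} {Φ Ψ : ℝ → ℝ}

/-- A sequence with summable modulars is order bounded. -/
lemma supMem_of_tsum_ne_top (hΨ : IsYoung Ψ) {x : ℕ → Ω → ℝ} (hx : ∀ k, Measurable (x k))
    {c : ℝ} (hc : 0 < c)
    (hsum : ∑' k, ∫⁻ ω, ENNReal.ofReal (Ψ (c * x k ω)) ∂P ≠ ⊤) : supMem P Ψ x := by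
  have hm : ∀ k, Measurable fun ω => ENNReal.ofReal (Ψ (c * x k ω)) := fun k =>
    (hΨ.continuous.measurable.comp ((hx k).const_mul c)).ennreal_ofReal
  have hsum' : ∫⁻ ω, ∑' k, ENNReal.ofReal (Ψ (c * x k ω)) ∂P ≠ ⊤ := by
    rwa [lintegral_tsum fun k => (hm k).aemeasurable]
  obtain ⟨R, hR, hlin⟩ := hΨ.exists_linear_le 1
  have hfin := ae_lt_top (Measurable.tsum hm) hsum'
  have hle : ∀ᵐ ω ∂P, ∃ S : ℝ, 0 ≤ S ∧
      ENNReal.ofReal S = ∑' k, ENNReal.ofReal (Ψ (c * x k ω)) ∧ ∀ k, Ψ (c * x k ω) ≤ S := by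
    filter_upwards [hfin] with ω hω
    refine ⟨_, ENNReal.toReal_nonneg, ENNReal.ofReal_toReal hω.ne, fun k => ?_⟩
    exact (ENNReal.ofReal_le_iff_le_toReal hω.ne).1
      (ENNReal.le_tsum (f := fun k => ENNReal.ofReal (Ψ (c * x k ω))) k)
  have hbdd : ∀ᵐ ω ∂P, BddAbove (range fun n => |x n ω|) := by
    filter_upwards [hle] with ω ⟨S, hS, _, hk⟩
    refine ⟨(R + S) / c, ?_⟩
    rintro _ ⟨k, rfl⟩
    rw [le_div_iff₀ hc, mul_comm, ← abs_of_pos hc, ← abs_mul]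
    rcases le_total R |c * x k ω| with h | h
    · linarith [hlin _ h, hk k]
    · linarith
  refine ⟨hbdd, Measurable.iSup fun k => measurable_abs.comp (hx k), c, hc,
    lt_of_le_of_lt (lintegral_mono_ae ?_) hsum'.lt_top⟩
  filter_upwards [hle, hbdd] with ω ⟨S, hS, hSe, hk⟩ hb
  rw [← hSe]
  refine ENNReal.ofReal_le_ofReal ?_
  have hcl : IsClosed {y : ℝ | Ψ (c * y) ≤ S} :=
    isClosed_le (hΨ.continuous.comp (continuous_const.mul continuous_id)) continuous_const
  refine hcl.closure_subset_iff.2 ?_ (csSup_mem_closure (range_nonempty _) hb)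
  rintro _ ⟨k, rfl⟩
  refine le_trans (hΨ.mono ?_) (hk k)
  simp [abs_mul]

lemma continuous_pairing_weakT {ζ : Ω → ℝ} {E F : Set (Ω → ℝ)} (hζ : ζ ∈ F) :
    @Continuous _ _ (weakT P E F) _ fun η : E => pairing P (η : Ω → ℝ) ζ := by
  let := weakT P E F
  have h : Continuous fun η : E => fun ξ : F => pairing P (η : Ω → ℝ) (ξ : Ω → ℝ) :=
    continuous_induced_dom
  exact (continuous_pi_iff.1 h) ⟨ζ, hζ⟩

/-- Modular and mean convergence to zero imply uniform convergence of the pairing on the compact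
sets defining the Mackey topology. -/
lemma eventually_abs_pairing_lt [IsProbabilityMeasure P] (hΦ : IsYoung Φ) {x : ℕ → Ω → ℝ}
    (hx : ∀ n, Measurable (x n)) {c : ℝ} (hc : 0 < c)
    (h1 : Tendsto (fun N => eLpNorm (x N) 1 P) atTop (𝓝 0))
    (h2 : Tendsto (fun N => ∫⁻ ω, ENNReal.ofReal (conj Φ (c * x N ω)) ∂P) atTop (𝓝 0))
    {A : Set (Orlicz P Φ)} (hA : @IsCompact _ (weakT P (Orlicz P Φ) (Orlicz P (conj Φ))) A)
    {ε : ℝ} (hε : 0 < ε) :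
    ∀ᶠ N in atTop, ∀ η ∈ A, |pairing P (x N) (η : Ω → ℝ)| < ε := by
  have hΨ := hΦ.isYoung_conj
  by_contra hcon
  have hpos : ∀ k : ℕ, (0 : ℝ≥0∞) < 2⁻¹ ^ k := fun k => by
    refine ENNReal.pow_pos (by simp) k
  have hfreq : ∀ k : ℕ, ∃ᶠ N in atTop, (∃ η ∈ A, ε ≤ |pairing P (x N) (η : Ω → ℝ)|) ∧
      eLpNorm (x N) 1 P ≤ 2⁻¹ ^ k ∧
      ∫⁻ ω, ENNReal.ofReal (conj Φ (c * x N ω)) ∂P ≤ 2⁻¹ ^ k := by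
    intro k
    refine (Filter.Frequently.and_eventually (not_eventually.1 hcon)
      ((h1.eventually (ge_mem_nhds (hpos k))).and
      (h2.eventually (ge_mem_nhds (hpos k))))).mono ?_
    rintro N ⟨h, h'⟩
    push Not at h
    exact ⟨h, h'⟩
  obtain ⟨φ, -, hφ⟩ := extraction_forall_of_frequently hfreq
  choose η hηA hη using fun k => (hφ k).1
  have hgeo : ∑' k : ℕ, (2⁻¹ : ℝ≥0∞) ^ k ≠ ⊤ := by
    rw [ENNReal.tsum_geometric]
    simp
  obtain ⟨hbdd, hζ⟩ := supMem_of_tsum_ne_top hΨ (fun k => hx (φ k)) hc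
    (ne_top_of_le_ne_top hgeo (ENNReal.tsum_le_tsum fun k => (hφ k).2.2))
  have hx0 : ∀ᵐ ω ∂P, Tendsto (fun k => x (φ k) ω) atTop (𝓝 0) := by
    have hL : ∫⁻ ω, ∑' k, ‖x (φ k) ω‖ₑ ∂P ≠ ⊤ := by
      rw [lintegral_tsum fun k => (hx (φ k)).enorm.aemeasurable]
      refine ne_top_of_le_ne_top hgeo (ENNReal.tsum_le_tsum fun k => ?_)
      rw [← eLpNorm_one_eq_lintegral_enorm]
      exact (hφ k).2.1
    filter_upwards [ae_lt_top (Measurable.tsum fun k => (hx (φ k)).enorm) hL] with ω hω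
    exact tendsto_zero_iff_enorm_tendsto_zero.2
      (ENNReal.tendsto_atTop_zero_of_tsum_ne_top hω.ne)
  set ζ : Ω → ℝ := fun ω => ⨆ k, |x (φ k) ω| with hζdef
  set g : ℕ → Ω → ℝ := fun k ω => if |x (φ k) ω| ≤ ζ ω then x (φ k) ω / ζ ω else 0 with hg
  have hζ0 : ∀ ω, 0 ≤ ζ ω := fun ω => Real.iSup_nonneg fun k => abs_nonneg _
  have hle : ∀ᵐ ω ∂P, ∀ k, |x (φ k) ω| ≤ ζ ω := by
    filter_upwards [hbdd] with ω hω k using le_ciSup hω k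
  have hcont : ∀ G : Ω → ℝ, Measurable G → (∀ᵐ ω ∂P, |G ω| ≤ 1) →
      @Continuous _ _ (weakT P (Orlicz P Φ) (Orlicz P (conj Φ))) _
        fun a : Orlicz P Φ => ∫ ω, G ω * (ζ ω * (a : Ω → ℝ) ω) ∂P := by
    intro G hGm hG1
    have hGζ : (fun ω => G ω * ζ ω) ∈ Orlicz P (conj Φ) := by
      refine hζ.mono hΨ (hGm.mul hζ.1) ?_
      filter_upwards [hG1] with ω hω
      rw [abs_mul]
      exact mul_le_of_le_one_left (abs_nonneg _) hω
    convert continuous_pairing_weakT (P := P) (E := Orlicz P Φ) hGζ using 2 with a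
    rw [pairing]
    congr 1 with ω
    ring
  refine @not_forall_le_abs_integral _ _ P _ (Orlicz P Φ)
    (weakT P (Orlicz P Φ) (Orlicz P (conj Φ))) A hA (fun a ω => ζ ω * (a : Ω → ℝ) ω)
    (fun a _ => ?_) hcont g (fun k => ?_) (fun k ω => ?_) ?_ η hηA ε hε fun k => ?_
  · simpa only [mul_comm] using MemOrlicz.integrable_mul a.2 hζ hΦ
  · exact Measurable.ite (measurableSet_le (measurable_abs.comp (hx _)) hζ.1)
      ((hx _).div hζ.1) measurable_const
  · simp only [hg]
    split_ifs with h
    · rw [abs_div, abs_of_nonneg (hζ0 ω)]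
      exact div_le_one_of_le₀ h (hζ0 ω)
    · simp
  · filter_upwards [hx0, hle] with ω h h'
    simp only [hg, h', if_true]
    simpa using h.div_const (ζ ω)
  · refine (hη k).trans (le_of_eq ?_)
    congr 1
    refine integral_congr_ae ?_
    filter_upwards [hle] with ω h
    simp only [hg, h k, if_true]
    rcases eq_or_ne (ζ ω) 0 with h0 | h0
    · have : x (φ k) ω = 0 := by simpa [h0] using h k
      simp [this]
    · field_simp

end MackeyConvergence

section Atomless

variable {Ω : Type*} [MeasurableSpace Ω] {P : Measure Ω}

lemma exists_subset_measure_le_of_atomless [IsFiniteMeasure P]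
    (hatomless : ∀ A : Set Ω, MeasurableSet A → 0 < P A →
      ∃ B ⊆ A, MeasurableSet B ∧ 0 < P B ∧ P B < P A)
    {A : Set Ω} (hA : MeasurableSet A) (hPA : 0 < P A) {ε : ℝ≥0∞} (hε : 0 < ε) :
    ∃ B ⊆ A, MeasurableSet B ∧ 0 < P B ∧ P B ≤ ε := by
  have hhalf : ∀ n : ℕ, ∃ B ⊆ A, MeasurableSet B ∧ 0 < P B ∧ P B ≤ 2⁻¹ ^ n * P A := by
    intro n
    induction n with
    | zero => exact ⟨A, Subset.rfl, hA, hPA, by simp⟩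
    | succ n ih =>
      obtain ⟨B, hBA, hB, hB0, hBn⟩ := ih
      obtain ⟨C, hCB, hC, hC0, hClt⟩ := hatomless B hB hB0
      have hadd : P C + P (B \ C) = P B := by
        rw [measure_sdiff hCB hC.nullMeasurableSet (measure_ne_top _ _),
          add_tsub_cancel_of_le hClt.le]
      have hle : ∀ {s t : ℝ≥0∞}, s + t = P B → s ≤ t → s ≤ 2⁻¹ ^ (n + 1) * P A := by
        intro s t hst h
        rw [pow_succ', mul_assoc, ← one_mul s, ← ENNReal.inv_mul_cancel two_ne_zero
          ENNReal.ofNat_ne_top, mul_assoc, two_mul]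
        gcongr
        exact (add_le_add le_rfl h).trans (hst.le.trans hBn)
      rcases le_total (P C) (P (B \ C)) with h | h
      · exact ⟨C, hCB.trans hBA, hC, hC0, hle hadd h⟩
      · refine ⟨B \ C, sdiff_subset.trans hBA, hB.diff hC, ?_, hle (by rw [add_comm, hadd]) h⟩
        rw [measure_sdiff hCB hC.nullMeasurableSet (measure_ne_top _ _)]
        exact tsub_pos_of_lt hClt
  have hlim : Tendsto (fun n : ℕ => (2⁻¹ : ℝ≥0∞) ^ n * P A) atTop (𝓝 0) := by
    have := ENNReal.Tendsto.mul_const (b := P A)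
      (ENNReal.tendsto_pow_atTop_nhds_zero_of_lt_one (r := 2⁻¹) (by simp))
      (Or.inr (measure_ne_top P A))
    simpa using this
  obtain ⟨n, hn⟩ := (hlim.eventually (ge_mem_nhds hε)).exists
  obtain ⟨B, hBA, hB, hB0, hBn⟩ := hhalf n
  exact ⟨B, hBA, hB, hB0, hBn.trans hn⟩

lemma exists_subset_half_le_measure_of_atomless [IsFiniteMeasure P]
    (hatomless : ∀ A : Set Ω, MeasurableSet A → 0 < P A →
      ∃ B ⊆ A, MeasurableSet B ∧ 0 < P B ∧ P B < P A)
    {A : Set Ω} (hA : MeasurableSet A) {t : ℝ≥0∞} (ht : 0 < t) (htA : t ≤ P A) :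
    ∃ B ⊆ A, MeasurableSet B ∧ t / 2 ≤ P B ∧ P B ≤ t := by
  by_contra! hcon
  set S : Set (Set Ω) := {B | B ⊆ A ∧ MeasurableSet B ∧ P B ≤ t} with hS
  have ht_top : t ≠ ⊤ := ne_top_of_le_ne_top (measure_ne_top P A) htA
  have hlt : ∀ B ∈ S, P B ≤ t / 2 := by
    rintro B ⟨hBA, hB, hBt⟩
    by_contra! h
    exact absurd hBt (not_le.2 (hcon B hBA hB h.le))
  have hunion : ∀ B ∈ S, ∀ C ∈ S, B ∪ C ∈ S := fun B hB C hC =>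
    ⟨union_subset hB.1 hC.1, hB.2.1.union hC.2.1, (measure_union_le B C).trans
      ((add_le_add (hlt B hB) (hlt C hC)).trans (ENNReal.add_halves t).le)⟩
  have hempty : ∅ ∈ S := ⟨empty_subset _, MeasurableSet.empty, by simp⟩
  obtain ⟨u, -, hu, huS⟩ := exists_seq_tendsto_sSup (S := P '' S) ⟨_, ∅, hempty, rfl⟩
    (OrderTop.bddAbove _)
  choose B hBS hBu using huS
  have hacc : ∀ n, accumulate B n ∈ S := by
    intro n
    induction n with
    | zero => simpa [accumulate_zero_nat] using hBS 0
    | succ n ih =>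
      rw [accumulate_succ]
      exact hunion _ ih _ (hBS _)
  have hUS : (⋃ n, B n) ∈ S := by
    refine ⟨iUnion_subset fun n => (hBS n).1, MeasurableSet.iUnion fun n => (hBS n).2.1, ?_⟩
    exact le_of_tendsto (tendsto_measure_iUnion_accumulate (μ := P) (f := B))
      (Eventually.of_forall fun n => (hacc n).2.2)
  have hsup : ∀ C ∈ S, P C ≤ P (⋃ n, B n) := fun C hC =>
    (le_sSup (mem_image_of_mem P hC)).trans (le_of_tendsto hu (Eventually.of_forall fun n => by
      rw [← hBu]
      exact measure_mono (subset_iUnion B n)))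
  have hrest : 0 < P (A \ ⋃ n, B n) := by
    rw [measure_sdiff hUS.1 hUS.2.1.nullMeasurableSet (measure_ne_top _ _)]
    refine tsub_pos_of_lt (lt_of_le_of_lt (hlt _ hUS) (lt_of_lt_of_le ?_ htA))
    exact ENNReal.half_lt_self ht.ne' ht_top
  obtain ⟨C, hCA, hC, hC0, hCt⟩ := exists_subset_measure_le_of_atomless hatomless
    (hA.diff hUS.2.1) hrest (ε := t / 2) (ENNReal.half_pos ht.ne')
  have hCS : C ∈ S := ⟨hCA.trans sdiff_subset, hC, hCt.trans ENNReal.half_le_self⟩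
  have h := hsup _ (hunion _ hUS _ hCS)
  rw [measure_union (disjoint_sdiff_right.mono_right hCA) hC] at h
  exact absurd h (not_le.2 (ENNReal.lt_add_right (measure_ne_top _ _) hC0.ne'))

/-- On an atomless probability space there are disjoint sets whose measures are prescribed up to
a factor of two. -/
lemma exists_pairwise_disjoint_of_atomless [IsProbabilityMeasure P]
    (hatomless : ∀ A : Set Ω, MeasurableSet A → 0 < P A →
      ∃ B ⊆ A, MeasurableSet B ∧ 0 < P B ∧ P B < P A)
    {p : ℕ → ℝ≥0∞} (hp : ∀ n, 0 < p n) (hsum : ∑' n, p n ≤ 1) :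
    ∃ A : ℕ → Set Ω, (∀ n, MeasurableSet (A n)) ∧ Pairwise (Function.onFun Disjoint A) ∧
      ∀ n, p n / 2 ≤ P (A n) ∧ P (A n) ≤ p n := by
  have hstep : ∀ (n : ℕ) (U : {U : Set Ω // MeasurableSet U}),
      ∃ V : {V : Set Ω // MeasurableSet V}, U.1 ⊆ V.1 ∧
        (P U.1 + p n ≤ 1 → p n / 2 ≤ P (V.1 \ U.1) ∧ P (V.1 \ U.1) ≤ p n) := by
    rintro n ⟨U, hU⟩
    by_cases h : P U + p n ≤ 1
    · obtain ⟨B, hBU, hB, h1, h2⟩ := exists_subset_half_le_measure_of_atomless hatomless hU.compl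
        (hp n) (by
          rw [prob_compl_eq_one_sub hU]
          exact ENNReal.le_sub_of_add_le_left (measure_ne_top _ _) h)
      refine ⟨⟨U ∪ B, hU.union hB⟩, subset_union_left, fun _ => ?_⟩
      have : (U ∪ B) \ U = B := by
        rw [union_sdiff_left, (disjoint_compl_left.mono_left hBU).sdiff_eq_left]
      simpa only [this] using ⟨h1, h2⟩
    · exact ⟨⟨U, hU⟩, Subset.rfl, fun h' => absurd h' h⟩
  choose V hUV hV using hstep
  let U : ℕ → {U : Set Ω // MeasurableSet U} := fun n => Nat.rec ⟨∅, MeasurableSet.empty⟩ V n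
  have hUmono : Monotone fun n => (U n).1 := monotone_nat_of_le_succ fun n => hUV n (U n)
  have hple : ∀ n, ∑ k ∈ Finset.range n, p k ≤ 1 := fun n => (ENNReal.sum_le_tsum _).trans hsum
  have hPU : ∀ n, P (U n).1 ≤ ∑ k ∈ Finset.range n, p k := by
    intro n
    induction n with
    | zero => exact le_of_eq (measure_empty (μ := P))
    | succ n ih =>
      have hn : P (U n).1 + p n ≤ 1 := by
        refine (add_le_add ih le_rfl).trans ?_
        rw [← Finset.sum_range_succ]
        exact hple _
      rw [Finset.sum_range_succ, ← union_sdiff_cancel (hUV n (U n) : (U n).1 ⊆ (U (n + 1)).1)]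
      exact (measure_union_le _ _).trans (add_le_add ih (hV n (U n) hn).2)
  refine ⟨fun n => (U (n + 1)).1 \ (U n).1, fun n => (U (n + 1)).2.diff (U n).2, ?_, fun n => ?_⟩
  · refine (pairwise_disjoint_on _).2 fun i j hij => ?_
    exact disjoint_sdiff_right.mono_left (sdiff_subset.trans (hUmono hij))
  · refine hV n (U n) ((add_le_add (hPU n) le_rfl).trans ?_)
    rw [← Finset.sum_range_succ]
    exact hple _

end Atomless

section NotDelta2

variable {Ω : Type*} [MeasurableSpace Ω] {P : Measure Ω} {Φ : ℝ → ℝ}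

lemma IsYoung.conj_div_two_mul_le (hΦ : IsYoung Φ) {q x : ℝ} (hx : 0 < x) (hq : 0 ≤ q)
    (hqx : q ≤ Φ (2 * x)) : conj Φ (q / (2 * x)) ≤ q := by
  refine conj_le fun z => ?_
  have h2x : 0 < 2 * x := by linarith
  rcases le_total z (2 * x) with hz | hz
  · have : z * (q / (2 * x)) ≤ q := by
      rw [mul_div_assoc', div_le_iff₀ h2x]
      nlinarith
    linarith [hΦ.nonneg z]
  · have hz0 : 0 < z := h2x.trans_le hz
    have h := hΦ.map_mul_le (t := 2 * x / z) (by positivity) (div_le_one_of_le₀ hz hz0.le) z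
    rw [div_mul_cancel₀ _ hz0.ne', div_mul_eq_mul_div, le_div_iff₀ hz0] at h
    have : z * (q / (2 * x)) ≤ Φ z := by
      rw [mul_div_assoc', div_le_iff₀ h2x]
      nlinarith
    linarith

/-- If `Φ` fails the Δ₂-condition on an atomless space, there is a sequence in the unit ball of
`L_{Φ*}` with disjoint supports whose pairing with a single element of `L_Φ` is bounded below. -/
lemma exists_disjoint_seq_of_not_delta2 [IsProbabilityMeasure P]
    (hatomless : ∀ A : Set Ω, MeasurableSet A → 0 < P A →
      ∃ B ⊆ A, MeasurableSet B ∧ 0 < P B ∧ P B < P A)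
    (hΦ : IsYoung Φ) (hΔ : ¬ Delta2 Φ) :
    ∃ (ξ : ℕ → Ω → ℝ) (η : Ω → ℝ) (A : ℕ → Set Ω),
      (∀ n, MemOrlicz P (conj Φ) (ξ n)) ∧ (∀ n, luxNorm P (conj Φ) (ξ n) ≤ 1) ∧
      MemOrlicz P Φ η ∧ (∀ n, MeasurableSet (A n)) ∧ Pairwise (Function.onFun Disjoint A) ∧
      (∀ ω, (∀ n, ω ∉ A n) → η ω = 0) ∧ (∀ n k, k < n → ∀ ω ∈ A k, ξ n ω = 0) ∧
      ∀ n, 1 / 4 ≤ pairing P (ξ n) η := by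
  have hΨ := hΦ.isYoung_conj
  obtain ⟨R, hR, hlin⟩ := hΦ.exists_linear_le 1
  have hex : ∀ n : ℕ, ∃ x : ℝ, 1 ≤ x ∧ 1 ≤ Φ x ∧ 2 ^ (n + 1) * Φ x ≤ Φ (2 * x) := by
    intro n
    by_contra! hcon
    refine hΔ ⟨2 ^ (n + 1), max R 1, fun x hx => (hcon x ((le_max_right _ _).trans hx) ?_).le⟩
    have h1 : 1 ≤ x := (le_max_right _ _).trans hx
    have h := hlin x (((le_max_left _ _).trans hx).trans (le_abs_self x))
    rw [abs_of_nonneg (by linarith)] at h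
    linarith
  choose x hx1 hΦx hx2 using hex
  set q : ℕ → ℝ := fun n => 2 ^ (n + 1) * Φ (x n) with hq
  have hx0 : ∀ n, 0 < x n := fun n => by linarith [hx1 n]
  have hΦ0 : ∀ n, 0 < Φ (x n) := fun n => by linarith [hΦx n]
  have hq0 : ∀ n, 0 < q n := fun n => mul_pos (by positivity) (hΦ0 n)
  set p : ℕ → ℝ≥0∞ := fun n => ENNReal.ofReal (1 / q n) with hp
  have hgeo : ∑' n : ℕ, ENNReal.ofReal ((1 / 2) ^ (n + 1)) ≤ 1 := by
    rw [← ENNReal.ofReal_tsum_of_nonneg (fun n => by positivity)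
      ((summable_nat_add_iff 1).2 summable_geometric_two)]
    refine ENNReal.ofReal_le_one.2 ?_
    simp only [pow_succ]
    rw [tsum_mul_right, tsum_geometric_two]
    norm_num
  have hpΦ : ∀ n, ENNReal.ofReal (Φ (x n)) * p n = ENNReal.ofReal ((1 / 2) ^ (n + 1)) := by
    intro n
    rw [hp, ← ENNReal.ofReal_mul (hΦ0 n).le]
    congr 1
    simp only [hq]
    have := (hΦ0 n).ne'
    field_simp
    rw [← mul_pow]
    norm_num
  have hple : ∀ n, p n ≤ ENNReal.ofReal ((1 / 2) ^ (n + 1)) := fun n => by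
    rw [← hpΦ n]
    refine le_mul_of_one_le_left' ?_
    simpa using hΦx n
  obtain ⟨A, hAm, hAd, hPA⟩ := exists_pairwise_disjoint_of_atomless (P := P) hatomless (p := p)
    (fun n => ENNReal.ofReal_pos.2 (by have := hq0 n; positivity))
    ((ENNReal.tsum_le_tsum hple).trans hgeo)
  set η : Ω → ℝ := fun ω =>
    (∑' n, (A n).indicator (fun _ => ENNReal.ofReal (x n)) ω).toReal with hη
  have hnot : ∀ {ω n k}, ω ∈ A n → k ≠ n → ω ∉ A k := fun hω hk h =>
    disjoint_left.1 (hAd hk) h hω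
  have hηA : ∀ n, ∀ ω ∈ A n, η ω = x n := by
    intro n ω hω
    simp only [hη]
    rw [tsum_eq_single n fun k hk => indicator_of_notMem (hnot hω hk) _,
      indicator_of_mem hω, ENNReal.toReal_ofReal (hx0 n).le]
  have hηc : ∀ ω, (∀ n, ω ∉ A n) → η ω = 0 := by
    intro ω hω
    simp [hη, indicator_of_notMem (hω _)]
  have hηm : Measurable η :=
    (Measurable.tsum fun n => measurable_const.indicator (hAm n)).ennreal_toReal
  have hηmem : MemOrlicz P Φ η := by
    refine ⟨hηm, 1, one_pos, lt_of_le_of_lt ?_ ENNReal.one_lt_top⟩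
    have hle : ∀ ω, ENNReal.ofReal (Φ (1 * η ω)) ≤
        ∑' n, (A n).indicator (fun _ => ENNReal.ofReal (Φ (x n))) ω := by
      intro ω
      rw [one_mul]
      by_cases h : ∃ n, ω ∈ A n
      · obtain ⟨n, hn⟩ := h
        rw [hηA n ω hn]
        refine le_trans (le_of_eq ?_) (ENNReal.le_tsum n)
        rw [indicator_of_mem hn]
      · push Not at h
        simp [hηc ω h, hΦ.map_zero]
    refine (lintegral_mono hle).trans ?_
    rw [lintegral_tsum fun n => (measurable_const.indicator (hAm n)).aemeasurable]
    refine le_trans (ENNReal.tsum_le_tsum fun n => ?_) hgeo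
    rw [lintegral_indicator_const (hAm n), ← hpΦ n]
    exact mul_le_mul' le_rfl (hPA n).2
  set ξ : ℕ → Ω → ℝ := fun n => (A n).indicator fun _ => q n / (2 * x n) with hξ
  have hξm : ∀ n, Measurable (ξ n) := fun n => measurable_const.indicator (hAm n)
  have hξ1 : ∀ n, ∫⁻ ω, ENNReal.ofReal (conj Φ (ξ n ω)) ∂P ≤ 1 := by
    intro n
    have heq : (fun ω => ENNReal.ofReal (conj Φ (ξ n ω))) =
        (A n).indicator fun _ => ENNReal.ofReal (conj Φ (q n / (2 * x n))) := by
      ext ω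
      by_cases h : ω ∈ A n <;> simp [hξ, h, hΨ.map_zero]
    rw [heq, lintegral_indicator_const (hAm n)]
    refine (mul_le_mul' (ENNReal.ofReal_le_ofReal
      (hΦ.conj_div_two_mul_le (hx0 n) (hq0 n).le (hx2 n))) (hPA n).2).trans (le_of_eq ?_)
    rw [hp, ← ENNReal.ofReal_mul (hq0 n).le, mul_one_div_cancel (hq0 n).ne', ENNReal.ofReal_one]
  refine ⟨ξ, η, A, fun n => ⟨hξm n, 1, one_pos, ?_⟩, fun n => luxNorm_le_one (hξ1 n), hηmem, hAm,
    hAd, hηc, fun n k hk ω hω => indicator_of_notMem (hnot hω hk.ne') _, fun n => ?_⟩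
  · simpa only [one_mul] using (hξ1 n).trans_lt ENNReal.one_lt_top
  · have heq : (fun ω => ξ n ω * η ω) = (A n).indicator fun _ => q n / 2 := by
      ext ω
      by_cases h : ω ∈ A n
      · simp only [hξ, indicator_of_mem h, hηA n ω h]
        have := (hx0 n).ne'
        field_simp
      · simp [hξ, h]
    rw [pairing, heq, integral_indicator_const _ (hAm n), smul_eq_mul]
    have hreal : 1 / q n / 2 ≤ P.real (A n) := by
      rw [← ENNReal.toReal_ofReal (r := 1 / q n / 2) (by have := hq0 n; positivity)]
      refine ENNReal.toReal_mono (measure_ne_top _ _) (le_trans (le_of_eq ?_) (hPA n).1)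
      rw [hp, ENNReal.ofReal_div_of_pos two_pos]
      simp
    calc (1 : ℝ) / 4 = 1 / q n / 2 * (q n / 2) := by
          have := (hq0 n).ne'
          field_simp
          norm_num
      _ ≤ _ := mul_le_mul_of_nonneg_right hreal (by have := hq0 n; positivity)

/-- Forward convex combinations of the sequence inherit the lower bound and the vanishing. -/
lemma FwdConvComb.le_pairing (hΦ : IsYoung Φ) {ξ ξb : ℕ → Ω → ℝ} {η : Ω → ℝ} {A : ℕ → Set Ω}
    {c : ℝ} (h : FwdConvComb ξ ξb) (hξ : ∀ n, MemOrlicz P (conj Φ) (ξ n)) (hη : MemOrlicz P Φ η)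
    (hA : ∀ n k, k < n → ∀ ω ∈ A k, ξ n ω = 0) (hc : ∀ n, c ≤ pairing P (ξ n) η) (n : ℕ) :
    c ≤ pairing P (ξb n) η ∧ ∀ k < n, ∀ ω ∈ A k, ξb n ω = 0 := by
  have hΨ := hΦ.isYoung_conj
  have hconv : Convex ℝ {g : Ω → ℝ | MemOrlicz P (conj Φ) g ∧ c ≤ pairing P g η ∧
      ∀ k < n, ∀ ω ∈ A k, g ω = 0} := by
    rintro f ⟨hf, hf1, hf2⟩ g ⟨hg, hg1, hg2⟩ a b ha hb hab
    refine ⟨convex_orlicz hΨ hf hg ha hb hab, ?_, fun k hk ω hω => ?_⟩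
    · have hfi := (hη.integrable_mul hf hΦ).const_mul a
      have hgi := (hη.integrable_mul hg hΦ).const_mul b
      have : pairing P (a • f + b • g) η = a * pairing P f η + b * pairing P g η := by
        rw [pairing_comm f, pairing_comm g, pairing, pairing, pairing, ← integral_const_mul,
          ← integral_const_mul, ← integral_add hfi hgi]
        congr 1 with ω
        simp only [Pi.add_apply, Pi.smul_apply, smul_eq_mul]
        ring
      rw [this]
      calc c = a * c + b * c := by rw [← add_mul, hab, one_mul]
        _ ≤ _ := add_le_add (mul_le_mul_of_nonneg_left hf1 ha) (mul_le_mul_of_nonneg_left hg1 hb)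
    · simp [hf2 k hk ω hω, hg2 k hk ω hω]
  refine (convexHull_min ?_ hconv (h n)).2
  rintro _ ⟨k, hk, rfl⟩
  exact ⟨hξ k, hc k, fun i hi => hA k i (hi.trans_le hk)⟩

lemma tendsto_pairing_of_tendsto_weakT {E F : Set (Ω → ℝ)} {f : ℕ → E} {f₀ : E}
    (h : Tendsto f atTop (@nhds _ (weakT P E F) f₀)) {η : Ω → ℝ} (hη : η ∈ F) :
    Tendsto (fun n => pairing P (f n : Ω → ℝ) η) atTop (𝓝 (pairing P (f₀ : Ω → ℝ) η)) :=
  (@Continuous.tendsto _ _ (weakT P E F) _ _ (continuous_pairing_weakT hη) f₀).comp h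

lemma delta2_of_weakT [IsProbabilityMeasure P]
    (hatomless : ∀ A : Set Ω, MeasurableSet A → 0 < P A →
      ∃ B ⊆ A, MeasurableSet B ∧ 0 < P B ∧ P B < P A)
    (hΦ : IsYoung Φ)
    (h : ∀ ξ : ℕ → Ω → ℝ, (∀ n, MemOrlicz P (conj Φ) (ξ n)) →
        (∃ M : ℝ, ∀ n, luxNorm P (conj Φ) (ξ n) ≤ M) →
        ∃ ξb : ℕ → Ω → ℝ, FwdConvComb ξ ξb ∧
          ∃ ξ₀ : Ω → ℝ, ∃ h₀ : ξ₀ ∈ Orlicz P (conj Φ),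
            ∃ hc : ∀ n, ξb n ∈ Orlicz P (conj Φ),
              Tendsto (fun n => (⟨ξb n, hc n⟩ : Orlicz P (conj Φ))) atTop
                (@nhds _ (weakT P (Orlicz P (conj Φ)) (Orlicz P Φ)) ⟨ξ₀, h₀⟩)) :
    Delta2 Φ := by
  by_contra hΔ
  obtain ⟨ξ, η, A, hξ, hξ1, hη, hAm, hAd, hηc, hA, hc⟩ :=
    exists_disjoint_seq_of_not_delta2 hatomless hΦ hΔ
  obtain ⟨ξb, hb, ξ₀, h₀, hcb, hlim⟩ := h ξ hξ ⟨1, hξ1⟩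
  have key := hb.le_pairing hΦ hξ hη hA hc
  have hpos : 1 / 4 ≤ pairing P ξ₀ η :=
    ge_of_tendsto' (tendsto_pairing_of_tendsto_weakT hlim hη) fun n => (key n).1
  have hzero : ∀ k, ∫ ω in A k, ξ₀ ω * η ω ∂P = 0 := by
    intro k
    have hηk : (A k).indicator η ∈ Orlicz P Φ :=
      hη.mono hΦ (hη.1.indicator (hAm k)) (ae_of_all _ fun ω => by
        by_cases hω : ω ∈ A k <;> simp [hω])
    have hpair : ∀ g : Ω → ℝ, pairing P g ((A k).indicator η) = ∫ ω in A k, g ω * η ω ∂P := by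
      intro g
      rw [pairing, ← integral_indicator (hAm k)]
      congr 1 with ω
      by_cases hω : ω ∈ A k <;> simp [hω]
    have hl := tendsto_pairing_of_tendsto_weakT hlim hηk
    rw [hpair] at hl
    refine tendsto_nhds_unique hl (tendsto_const_nhds.congr' ?_)
    filter_upwards [eventually_gt_atTop k] with n hn
    rw [hpair]
    refine (setIntegral_eq_zero_of_forall_eq_zero fun ω hω => ?_).symm
    rw [(key n).2 k hn ω hω, zero_mul]
  have hfinint : Integrable (fun ω => ξ₀ ω * η ω) P := by
    simpa only [mul_comm] using hη.integrable_mul h₀ hΦ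
  have hsum : pairing P ξ₀ η = 0 := by
    rw [pairing, ← setIntegral_eq_integral_of_forall_compl_eq_zero (s := ⋃ n, A n),
      integral_iUnion hAm hAd hfinint.integrableOn]
    · simp [hzero]
    · intro ω hω
      rw [hηc ω fun n hn => hω (mem_iUnion_of_mem n hn), mul_zero]
  linarith

lemma delta2_of_supMem [IsProbabilityMeasure P]
    (hatomless : ∀ A : Set Ω, MeasurableSet A → 0 < P A →
      ∃ B ⊆ A, MeasurableSet B ∧ 0 < P B ∧ P B < P A)
    (hΦ : IsYoung Φ)
    (h : ∀ ξ : ℕ → Ω → ℝ, (∀ n, MemOrlicz P (conj Φ) (ξ n)) →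
        (∃ M : ℝ, ∀ n, luxNorm P (conj Φ) (ξ n) ≤ M) →
        ∃ ξb : ℕ → Ω → ℝ, FwdConvComb ξ ξb ∧ supMem P (conj Φ) ξb) :
    Delta2 Φ := by
  by_contra hΔ
  obtain ⟨ξ, η, A, hξ, hξ1, hη, hAm, hAd, hηc, hA, hc⟩ :=
    exists_disjoint_seq_of_not_delta2 hatomless hΦ hΔ
  obtain ⟨ξb, hb, hbdd, hζ⟩ := h ξ hξ ⟨1, hξ1⟩
  have key := hb.le_pairing hΦ hξ hη hA hc
  have hlim : Tendsto (fun n => pairing P (ξb n) η) atTop (𝓝 (∫ _, (0 : ℝ) ∂P)) := by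
    refine tendsto_integral_of_dominated_convergence
      (fun ω => |η ω * (⨆ n, |ξb n ω|)|) (fun n => ?_) (hη.integrable_mul hζ hΦ).abs
      (fun n => ?_) (ae_of_all _ fun ω => ?_)
    · exact ((hb.memOrlicz hΦ.isYoung_conj hξ n).1.mul hη.1).aestronglyMeasurable
    · filter_upwards [hbdd] with ω hω
      rw [Real.norm_eq_abs, mul_comm, abs_mul, abs_mul]
      exact mul_le_mul_of_nonneg_left ((le_ciSup hω n).trans (le_abs_self _)) (abs_nonneg _)
    · by_cases hω : ∃ k, ω ∈ A k
      · obtain ⟨k, hk⟩ := hω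
        refine tendsto_const_nhds.congr' ?_
        filter_upwards [eventually_gt_atTop k] with n hn
        rw [(key n).2 k hn ω hk, zero_mul]
      · push Not at hω
        simp [hηc ω hω]
  have := ge_of_tendsto' hlim fun n => (key n).1
  norm_num at this

end NotDelta2

section Main

/-- The average of the terms with indices `N + 1, …, 2 N + 1` is a forward convex combination. -/
lemma two_mul_cesaro_sub_mem_convexHull {Ω : Type*} {n : ℕ → ℕ} (hn : StrictMono n)
    (ξ : ℕ → Ω → ℝ) (N : ℕ) :
    (fun ω => 2 * cesaro (fun i => ξ (n i)) (2 * N + 1) ω - cesaro (fun i => ξ (n i)) N ω) ∈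
      convexHull ℝ {g : Ω → ℝ | ∃ k ≥ N, g = ξ k} := by
  have hpos : (0 : ℝ) < (N : ℝ) + 1 := by positivity
  have heq : (fun ω => 2 * cesaro (fun i => ξ (n i)) (2 * N + 1) ω -
      cesaro (fun i => ξ (n i)) N ω) =
      ∑ i ∈ Finset.range (N + 1), ((N : ℝ) + 1)⁻¹ • ξ (n (N + 1 + i)) := by
    ext ω
    rw [← Finset.smul_sum, Pi.smul_apply, Finset.sum_apply, smul_eq_mul, cesaro, cesaro,
      show 2 * N + 1 + 1 = (N + 1) + (N + 1) by ring, Finset.sum_range_add]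
    push_cast
    field_simp
    ring
  rw [heq]
  refine (convex_convexHull ℝ _).sum_mem (fun _ _ => by positivity) ?_ fun i _ =>
    subset_convexHull ℝ _ ⟨n (N + 1 + i), ?_, rfl⟩
  · rw [Finset.sum_const, Finset.card_range, nsmul_eq_mul]
    push_cast
    exact mul_inv_cancel₀ hpos.ne'
  · have := hn.le_apply (x := N + 1 + i)
    omega
variable {Ω : Type*} [MeasurableSpace Ω] {P : Measure Ω} {Φ Ψ : ℝ → ℝ}

lemma Delta2.exists_subseq_tendsto_cesaro [IsProbabilityMeasure P] (hΔ : Delta2 Φ)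
    (hΦ : IsYoung Φ) {ξ : ℕ → Ω → ℝ} (hξ : ∀ n, MemOrlicz P (conj Φ) (ξ n)) {M : ℝ}
    (hM : ∀ n, luxNorm P (conj Φ) (ξ n) ≤ M) :
    ∃ n : ℕ → ℕ, StrictMono n ∧ ∃ ξ₀ : Ω → ℝ, MemOrlicz P (conj Φ) ξ₀ ∧ ∃ c : ℝ, 0 < c ∧
      Tendsto (fun N => eLpNorm (fun ω => cesaro (fun j => ξ (n j)) N ω - ξ₀ ω) 1 P)
        atTop (𝓝 0) ∧
      Tendsto (fun N => ∫⁻ ω, ENNReal.ofReal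
        (conj Φ (c * (cesaro (fun j => ξ (n j)) N ω - ξ₀ ω))) ∂P) atTop (𝓝 0) := by
  have hΨ := hΦ.isYoung_conj
  set K : ℝ := |M| + 1 with hK
  have hK0 : 0 < K := by positivity
  have hMK : M < K := by linarith [le_abs_self M]
  obtain ⟨n, hn, ξ₀, hξ₀, hξ₀1, h1, h2⟩ := hΨ.exists_subseq_tendsto_cesaro (P := P)
    (hΔ.conj_div_le hΦ) (ξ := fun n ω => ξ n ω / K) (fun n => (hξ n).1.div_const K)
    (fun n => lintegral_div_le_one hΨ (hξ n) (hM n) hMK)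
  have hces : ∀ N ω, cesaro (fun j => ξ (n j)) N ω - K * ξ₀ ω =
      K * (cesaro (fun j ω => ξ (n j) ω / K) N ω - ξ₀ ω) := by
    intro N ω
    simp only [cesaro, ← Finset.sum_div]
    field_simp
  refine ⟨n, hn, fun ω => K * ξ₀ ω, ?_, 1 / 4 / K, by positivity, ?_, ?_⟩
  · refine MemOrlicz.const_mul ⟨hξ₀, 1, one_pos, ?_⟩ hΨ K
    simpa only [one_mul] using hξ₀1.trans_lt ENNReal.one_lt_top
  · have heq : ∀ N, eLpNorm (fun ω => cesaro (fun j => ξ (n j)) N ω - K * ξ₀ ω) 1 P =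
        ‖K‖ₑ * eLpNorm (cesaro (fun j ω => ξ (n j) ω / K) N - ξ₀) 1 P := by
      intro N
      rw [← eLpNorm_const_smul]
      congr 1 with ω
      exact hces N ω
    simp only [heq]
    simpa using ENNReal.Tendsto.const_mul h1 (Or.inr enorm_ne_top)
  · refine h2.congr fun N => lintegral_congr fun ω => ?_
    rw [hces, ← mul_assoc, div_mul_cancel₀ _ hK0.ne']

lemma pairing_sub (hΦ : IsYoung Φ) {f g η : Ω → ℝ} (hf : MemOrlicz P (conj Φ) f)
    (hg : MemOrlicz P (conj Φ) g) (hη : MemOrlicz P Φ η) :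
    pairing P (fun ω => f ω - g ω) η = pairing P f η - pairing P g η := by
  rw [pairing_comm f, pairing_comm g, pairing, pairing, pairing,
    ← integral_sub (hη.integrable_mul hf hΦ) (hη.integrable_mul hg hΦ)]
  congr 1 with ω
  ring

lemma tendsto_mackeyT_iff {E F : Set (Ω → ℝ)} {f : ℕ → E} {f₀ : E} :
    Tendsto f atTop (@nhds _ (mackeyT P E F) f₀) ↔ ∀ A ∈ dualSets P E F, ∀ ε > 0,
      ∀ᶠ N in atTop, ∀ η ∈ A,
        |pairing P (f₀ : Ω → ℝ) (η : Ω → ℝ) - pairing P (f N : Ω → ℝ) (η : Ω → ℝ)| < ε := by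
  rw [mackeyT, nhds_induced, tendsto_comap_iff, UniformOnFun.tendsto_iff_tendstoUniformlyOn]
  simp only [Metric.tendstoUniformlyOn_iff, Real.dist_eq]
  rfl

/-- The segment spanned by `η` is one of the sets defining the Mackey topology. -/
lemma range_smul_mem_dualSets {E F : Set (Ω → ℝ)} {η : Ω → ℝ}
    (hη : ∀ t : ℝ, t • η ∈ F) :
    (fun t : ℝ => (⟨t • η, hη t⟩ : F)) '' Icc (-1) 1 ∈ dualSets P E F := by
  have himage : Subtype.val '' ((fun t : ℝ => (⟨t • η, hη t⟩ : F)) '' Icc (-1) 1) =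
      (fun t : ℝ => t • η) '' Icc (-1) 1 := by
    rw [image_image]
  refine ⟨?_, ?_, ?_⟩
  · rw [himage]
    exact (convex_Icc (-1 : ℝ) 1).is_linear_image
      ⟨fun a b => add_smul a b η, fun a b => smul_assoc a b η⟩
  · rw [himage, balanced_iff_smul_mem]
    rintro a ha _ ⟨t, ht, rfl⟩
    refine ⟨a * t, abs_le.1 ?_, mul_smul a t η⟩
    rw [abs_mul]
    exact mul_le_one₀ ha (abs_nonneg t) (abs_le.2 ht)
  · let := weakT P F E
    refine isCompact_Icc.image (continuous_induced_rng.2 (continuous_pi fun ζ => ?_))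
    have : ∀ t : ℝ, pairing P (t • η) (ζ : Ω → ℝ) = t * pairing P η (ζ : Ω → ℝ) := fun t => by
      simp only [pairing, Pi.smul_apply, smul_eq_mul, mul_assoc, integral_const_mul]
    simp only [Function.comp_def, this]
    exact continuous_id.mul continuous_const

lemma tendsto_pairing_of_tendsto_mackeyT {E : Set (Ω → ℝ)} (hΦ : IsYoung Φ) {f : ℕ → E} {f₀ : E}
    (h : Tendsto f atTop (@nhds _ (mackeyT P E (Orlicz P Φ)) f₀)) {η : Ω → ℝ}
    (hη : MemOrlicz P Φ η) :
    Tendsto (fun n => pairing P (f n : Ω → ℝ) η) atTop (𝓝 (pairing P (f₀ : Ω → ℝ) η)) := by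
  rw [Metric.tendsto_atTop']
  intro ε hε
  have hmem : ∀ t : ℝ, t • η ∈ Orlicz P Φ := fun t => hη.const_mul hΦ t
  have hev := tendsto_mackeyT_iff.1 h _ (range_smul_mem_dualSets hmem) ε hε
  obtain ⟨N, hN⟩ := eventually_atTop.1 hev
  refine ⟨N, fun n hn => ?_⟩
  have := hN n hn.le ⟨(1 : ℝ) • η, hmem 1⟩ ⟨1, ⟨by norm_num, le_rfl⟩, rfl⟩
  rw [Real.dist_eq, abs_sub_comm]
  simpa only [one_smul] using this

lemma Delta2.exists_tendsto_mackeyT [IsProbabilityMeasure P] (hΔ : Delta2 Φ) (hΦ : IsYoung Φ)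
    {ξ : ℕ → Ω → ℝ} (hξ : ∀ n, MemOrlicz P (conj Φ) (ξ n))
    (hM : ∃ M : ℝ, ∀ n, luxNorm P (conj Φ) (ξ n) ≤ M) :
    ∃ n : ℕ → ℕ, StrictMono n ∧
      ∃ ξ₀ : Ω → ℝ, ∃ h₀ : ξ₀ ∈ Orlicz P (conj Φ),
        ∃ hc : ∀ N, cesaro (fun i => ξ (n i)) N ∈ Orlicz P (conj Φ),
          Tendsto (fun N => (⟨cesaro (fun i => ξ (n i)) N, hc N⟩ : Orlicz P (conj Φ))) atTop
            (@nhds _ (mackeyT P (Orlicz P (conj Φ)) (Orlicz P Φ)) ⟨ξ₀, h₀⟩) := by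
  obtain ⟨M, hM⟩ := hM
  obtain ⟨n, hn, ξ₀, h₀, c, hc, h1, h2⟩ := hΔ.exists_subseq_tendsto_cesaro hΦ hξ hM
  have hmem : ∀ N, MemOrlicz P (conj Φ) (cesaro (fun i => ξ (n i)) N) :=
    memOrlicz_cesaro hΦ.isYoung_conj fun i => hξ (n i)
  refine ⟨n, hn, ξ₀, h₀, hmem, tendsto_mackeyT_iff.2 fun A hA ε hε => ?_⟩
  filter_upwards [eventually_abs_pairing_lt hΦ (fun N => (hmem N).1.sub h₀.1) hc h1 h2
    hA.2.2 hε] with N hN η hη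
  rw [abs_sub_comm, ← pairing_sub hΦ (hmem N) h₀ η.2]
  exact hN η hη

lemma exists_tendsto_weakT_of_mackeyT (hΦ : IsYoung Φ) {ξ : ℕ → Ω → ℝ}
    (hξ : ∀ n, MemOrlicz P (conj Φ) (ξ n)) {n : ℕ → ℕ} (hn : StrictMono n) {ξ₀ : Ω → ℝ}
    {h₀ : ξ₀ ∈ Orlicz P (conj Φ)} {hc : ∀ N, cesaro (fun i => ξ (n i)) N ∈ Orlicz P (conj Φ)}
    (h : Tendsto (fun N => (⟨cesaro (fun i => ξ (n i)) N, hc N⟩ : Orlicz P (conj Φ))) atTop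
      (@nhds _ (mackeyT P (Orlicz P (conj Φ)) (Orlicz P Φ)) ⟨ξ₀, h₀⟩)) :
    ∃ ξb : ℕ → Ω → ℝ, FwdConvComb ξ ξb ∧
      ∃ ξ₀ : Ω → ℝ, ∃ h₀ : ξ₀ ∈ Orlicz P (conj Φ),
        ∃ hc : ∀ n, ξb n ∈ Orlicz P (conj Φ),
          Tendsto (fun n => (⟨ξb n, hc n⟩ : Orlicz P (conj Φ))) atTop
            (@nhds _ (weakT P (Orlicz P (conj Φ)) (Orlicz P Φ)) ⟨ξ₀, h₀⟩) := by
  have hΨ := hΦ.isYoung_conj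
  have hfwd : FwdConvComb ξ fun N ω => 2 * cesaro (fun i => ξ (n i)) (2 * N + 1) ω -
      cesaro (fun i => ξ (n i)) N ω := two_mul_cesaro_sub_mem_convexHull hn ξ
  refine ⟨_, hfwd, ξ₀, h₀, hfwd.memOrlicz hΨ hξ, ?_⟩
  rw [weakT, nhds_induced, tendsto_comap_iff, tendsto_pi_nhds]
  rintro ⟨η, hη⟩
  have hlim := tendsto_pairing_of_tendsto_mackeyT hΦ h hη
  have h2N : Tendsto (fun N : ℕ => 2 * N + 1) atTop atTop :=
    tendsto_atTop_mono (fun N => by simp only [id]; omega) tendsto_id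
  have := ((hlim.comp h2N).const_mul 2).sub hlim
  rw [show 2 * pairing P ξ₀ η - pairing P ξ₀ η = pairing P ξ₀ η by ring] at this
  refine this.congr fun N => ?_
  simp only [Function.comp_def]
  rw [pairing_sub hΦ (MemOrlicz.const_mul (hc _) hΨ 2) (hc _) hη]
  congr 1
  simp only [pairing, mul_assoc, integral_const_mul]

lemma Delta2.exists_supMem [IsProbabilityMeasure P] (hΔ : Delta2 Φ) (hΦ : IsYoung Φ)
    {ξ : ℕ → Ω → ℝ} (hξ : ∀ n, MemOrlicz P (conj Φ) (ξ n))
    (hM : ∃ M : ℝ, ∀ n, luxNorm P (conj Φ) (ξ n) ≤ M) :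
    ∃ ξb : ℕ → Ω → ℝ, FwdConvComb ξ ξb ∧ supMem P (conj Φ) ξb := by
  have hΨ := hΦ.isYoung_conj
  obtain ⟨M, hM⟩ := hM
  obtain ⟨n, hn, ξ₀, h₀, c, hc, -, h2⟩ := hΔ.exists_subseq_tendsto_cesaro hΦ hξ hM
  have hcm : ∀ N, Measurable (cesaro (fun i => ξ (n i)) N) :=
    measurable_cesaro fun i => (hξ (n i)).1
  set b : ℕ → Ω → ℝ := fun N ω => 2 * cesaro (fun i => ξ (n i)) (2 * N + 1) ω -
      cesaro (fun i => ξ (n i)) N ω with hb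
  have hbm : ∀ N, Measurable (b N) := fun N => ((hcm _).const_mul 2).sub (hcm N)
  have h2N : Tendsto (fun N : ℕ => 2 * N + 1) atTop atTop :=
    tendsto_atTop_mono (fun N => by simp only [id]; omega) tendsto_id
  have hblock : Tendsto (fun N => ∫⁻ ω, ENNReal.ofReal (conj Φ (c / 4 * (b N ω - ξ₀ ω))) ∂P)
      atTop (𝓝 0) := by
    have hsum := (h2.comp h2N).add h2
    rw [add_zero] at hsum
    refine tendsto_of_tendsto_of_tendsto_of_le_of_le tendsto_const_nhds hsum
      (fun _ => zero_le) fun N => ?_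
    simp only [Function.comp_def]
    have hm : Measurable fun ω => ENNReal.ofReal
        (conj Φ (c * (cesaro (fun j => ξ (n j)) (2 * N + 1) ω - ξ₀ ω))) :=
      (hΨ.continuous.measurable.comp (((hcm _).sub h₀.1).const_mul c)).ennreal_ofReal
    rw [← lintegral_add_left hm]
    refine lintegral_mono fun ω => ?_
    rw [← ENNReal.ofReal_add (hΨ.nonneg _) (hΨ.nonneg _)]
    refine ENNReal.ofReal_le_ofReal ?_
    set u := cesaro (fun i => ξ (n i)) (2 * N + 1) ω - ξ₀ ω with hu
    set v := cesaro (fun i => ξ (n i)) N ω - ξ₀ ω with hv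
    have heq : c / 4 * (b N ω - ξ₀ ω) = 1 / 2 * (c * u) + 1 / 2 * (-(c * v) / 2) := by
      simp only [hb, hu, hv]
      ring
    have h1 := hΨ.add_le (c * u) (-(c * v) / 2) (a := 1 / 2) (b := 1 / 2) (by norm_num)
      (by norm_num) (by norm_num)
    have h3 : conj Φ (-(c * v) / 2) ≤ conj Φ (c * v) := hΨ.mono (by
      rw [abs_div, abs_neg, abs_of_pos (two_pos : (0 : ℝ) < 2)]
      linarith [abs_nonneg (c * v)])
    rw [heq]
    linarith [hΨ.nonneg (c * u), hΨ.nonneg (c * v)]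
  have hev : ∀ k : ℕ, ∀ᶠ N in atTop,
      ∫⁻ ω, ENNReal.ofReal (conj Φ (c / 4 * (b N ω - ξ₀ ω))) ∂P ≤ 2⁻¹ ^ k := fun k =>
    hblock.eventually (ge_mem_nhds (ENNReal.pow_pos (by simp) k))
  obtain ⟨φ, hφ, hφk⟩ := extraction_forall_of_eventually hev
  have hgeo : ∑' k : ℕ, (2⁻¹ : ℝ≥0∞) ^ k ≠ ⊤ := by
    rw [ENNReal.tsum_geometric]
    simp
  obtain ⟨hbdd, hζ⟩ := supMem_of_tsum_ne_top hΨ (x := fun k ω => b (φ k) ω - ξ₀ ω)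
    (fun k => (hbm (φ k)).sub h₀.1) (by positivity)
    (ne_top_of_le_ne_top hgeo (ENNReal.tsum_le_tsum hφk))
  have hle : ∀ᵐ ω ∂P, ∀ k, |b (φ k) ω| ≤ (⨆ k, |b (φ k) ω - ξ₀ ω|) + |ξ₀ ω| := by
    filter_upwards [hbdd] with ω hω k
    have h1 := le_ciSup hω k
    have h2 := abs_sub_abs_le_abs_sub (b (φ k) ω) (ξ₀ ω)
    linarith
  refine ⟨fun k => b (φ k), fun k => ?_, ?_, ?_⟩
  · refine convexHull_mono ?_ (two_mul_cesaro_sub_mem_convexHull hn ξ (φ k))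
    rintro _ ⟨i, hi, rfl⟩
    exact ⟨i, hφ.le_apply.trans hi, rfl⟩
  · filter_upwards [hle] with ω hω
    exact ⟨_, forall_mem_range.2 hω⟩
  · refine (hζ.add (h₀.abs hΨ) hΨ).mono hΨ
      (Measurable.iSup fun k => measurable_abs.comp (hbm (φ k))) ?_
    filter_upwards [hle] with ω hω
    rw [abs_of_nonneg (Real.iSup_nonneg fun k => abs_nonneg _)]
    exact (ciSup_le hω).trans (le_abs_self _)

end Main

/-- On an atomless probability space, for a Young function
`Φ` (not a priori `Δ₂`), the following are equivalent: (1) `Φ ∈ Δ₂`;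
(2) every norm-bounded sequence in `L_{Φ*}` has a subsequence with
`τ(L_{Φ*},L_Φ)`-convergent Cesàro means; (3) every norm-bounded sequence in
`L_{Φ*}` has a `σ(L_{Φ*},L_Φ)`-convergent sequence of forward convex
combinations; (4) every norm-bounded sequence in `L_{Φ*}` has an order-bounded
sequence of forward convex combinations. -/
theorem statement13
    {Ω : Type*} [MeasurableSpace Ω] (P : Measure Ω) [IsProbabilityMeasure P]
    (hatomless : ∀ A : Set Ω, MeasurableSet A → 0 < P A →
      ∃ B ⊆ A, MeasurableSet B ∧ 0 < P B ∧ P B < P A)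
    (Φ : ℝ → ℝ) (hΦ : IsYoung Φ) :
    -- (1) ↔ (2)
    ((Delta2 Φ) ↔
      (∀ ξ : ℕ → Ω → ℝ, (∀ n, MemOrlicz P (conj Φ) (ξ n)) →
        (∃ M : ℝ, ∀ n, luxNorm P (conj Φ) (ξ n) ≤ M) →
        ∃ n : ℕ → ℕ, StrictMono n ∧
          ∃ ξ₀ : Ω → ℝ, ∃ h₀ : ξ₀ ∈ Orlicz P (conj Φ),
            ∃ hc : ∀ N, cesaro (fun i => ξ (n i)) N ∈ Orlicz P (conj Φ),
              Tendsto (fun N => (⟨cesaro (fun i => ξ (n i)) N, hc N⟩ : Orlicz P (conj Φ)))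
                atTop
                (@nhds _ (mackeyT P (Orlicz P (conj Φ)) (Orlicz P Φ)) ⟨ξ₀, h₀⟩))) ∧
    -- (1) ↔ (3)
    ((Delta2 Φ) ↔
      (∀ ξ : ℕ → Ω → ℝ, (∀ n, MemOrlicz P (conj Φ) (ξ n)) →
        (∃ M : ℝ, ∀ n, luxNorm P (conj Φ) (ξ n) ≤ M) →
        ∃ ξb : ℕ → Ω → ℝ, FwdConvComb ξ ξb ∧
          ∃ ξ₀ : Ω → ℝ, ∃ h₀ : ξ₀ ∈ Orlicz P (conj Φ),
            ∃ hc : ∀ n, ξb n ∈ Orlicz P (conj Φ),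
              Tendsto (fun n => (⟨ξb n, hc n⟩ : Orlicz P (conj Φ))) atTop
                (@nhds _ (weakT P (Orlicz P (conj Φ)) (Orlicz P Φ)) ⟨ξ₀, h₀⟩))) ∧
    -- (1) ↔ (4)
    ((Delta2 Φ) ↔
      (∀ ξ : ℕ → Ω → ℝ, (∀ n, MemOrlicz P (conj Φ) (ξ n)) →
        (∃ M : ℝ, ∀ n, luxNorm P (conj Φ) (ξ n) ≤ M) →
        ∃ ξb : ℕ → Ω → ℝ, FwdConvComb ξ ξb ∧ supMem P (conj Φ) ξb)) := by
  refine ⟨⟨fun hΔ ξ hξ hM => hΔ.exists_tendsto_mackeyT hΦ hξ hM, fun h => ?_⟩,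
    ⟨fun hΔ ξ hξ hM => ?_, delta2_of_weakT hatomless hΦ⟩,
    ⟨fun hΔ ξ hξ hM => hΔ.exists_supMem hΦ hξ hM, delta2_of_supMem hatomless hΦ⟩⟩
  · refine delta2_of_weakT hatomless hΦ fun ξ hξ hM => ?_
    obtain ⟨n, hn, ξ₀, h₀, hc, hlim⟩ := h ξ hξ hM
    exact exists_tendsto_weakT_of_mackeyT hΦ hξ hn hlim
  · obtain ⟨n, hn, ξ₀, h₀, hc, hlim⟩ := hΔ.exists_tendsto_mackeyT hΦ hξ hM
    exact exists_tendsto_weakT_of_mackeyT hΦ hξ hn hlim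

end OrliczPaper
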